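/- arXiv:1307.4919 — 4 statements merged into one kernel-verified Lean document; each statement's English description precedes it below -/
import Mathlib

section
/- Let ν ∈ ℚ^n be a Newton datum and μ ∈ ℤ^n a decreasing tuple. Then there exists a constant C > 0 such that for every b ∈ GL_n(K) with μ(b) = μ which is σ-conjugate to b_{min,ν}, and every k ≥ 1: |μ((bσ)^k), μ(b_{min,ν}^k)| < C. -/
/-!
Statement 10.  Let `ν` be a Newton datum (encoded by its superbasic block data)
and `μ` a decreasing integer tuple.  There is a constant `C > 0` such that for
every `b ∈ GL_n(K)` with Hodge point `μ` which is `σ`-conjugate to `b_{min,ν}`,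
and every `k ≥ 1`: `|μ((bσ)^k), μ(b_{min,ν}^k)| < C`.
-/

open Matrix

noncomputable section

variable (p : ℕ) [Fact p.Prime] (κ : Type) [Field κ] [IsAlgClosed κ] [CharP κ p]

local notation "𝕎" => WittVector p κ
local notation "K" => FractionRing (WittVector p κ)

/-- `c ∈ GL_n(W(κ)) ⊆ GL_n(K)`. -/
def IsIntegralUnit {n : ℕ} (c : Matrix (Fin n) (Fin n) K) : Prop :=
  ∃ d : Matrix (Fin n) (Fin n) 𝕎, IsUnit d.det ∧ c = d.map (algebraMap 𝕎 K)

/-- `μ` is the Hodge point of `b`. -/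
def IsHodgePoint {n : ℕ} (b : Matrix (Fin n) (Fin n) K) (μ : Fin n → ℤ) : Prop :=
  Antitone μ ∧ ∃ c₁ c₂ : Matrix (Fin n) (Fin n) K, IsIntegralUnit p κ c₁ ∧ IsIntegralUnit p κ c₂ ∧
    b = c₁ * Matrix.diagonal (fun i => (p : K) ^ (μ i)) * c₂

/-- `twistedPow σ b i = (bσ)^i = b·σ(b)·σ²(b)···σ^{i−1}(b)`. -/
def twistedPow {n : ℕ} (σ : K ≃+* K) (b : Matrix (Fin n) (Fin n) K) :
    ℕ → Matrix (Fin n) (Fin n) K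
  | 0 => 1
  | (i + 1) => b * (twistedPow σ b i).map ⇑σ

/-- The matrix `B_{m,h}`. -/
def Bmat (m : ℕ) (h : ℤ) : Matrix (Fin m) (Fin m) K :=
  fun r j => if (r : ℤ) % m = ((j : ℤ) + h) % m then (p : K) ^ (((j : ℤ) + h) / m) else 0

/-- A Newton datum for `GL_n`, encoded by its superbasic blocks `(mᵢ, hᵢ)`
(coprime, slopes `hᵢ/mᵢ` weakly decreasing), block `i` occupying the `i`-th
consecutive segment of `Fin n`. -/
structure BlockData (n : ℕ) where
  /-- number of blocks -/
  len : ℕ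
  /-- sizes of the blocks -/
  m : Fin len → ℕ
  /-- numerators of the blocks -/
  h : Fin len → ℤ
  m_pos : ∀ i, 0 < m i
  coprime : ∀ i, Int.gcd (m i) (h i) = 1
  slopes_antitone : Antitone fun i => (h i : ℚ) / (m i)
  /-- the identification of the blocks with consecutive segments of `Fin n`, in order -/
  equiv : (Σ i : Fin len, Fin (m i)) ≃ Fin n
  equiv_val : ∀ x : (Σ i : Fin len, Fin (m i)),
    ((equiv x : ℕ)) = (∑ j : Fin len, if j < x.1 then m j else 0) + (x.2 : ℕ)

/-- The Newton point `ν` determined by the block data: `m i` slopes `h i / m i`. -/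
def nuOf {n : ℕ} (D : BlockData n) : Fin n → ℚ :=
  fun j => (D.h (D.equiv.symm j).1 : ℚ) / (D.m (D.equiv.symm j).1)

/-- The minimal element `b_{min,ν}`: block diagonal with blocks `B_{mᵢ,hᵢ}`. -/
def minMatrix {n : ℕ} (D : BlockData n) : Matrix (Fin n) (Fin n) K :=
  (Matrix.blockDiagonal' fun i => Bmat p κ (D.m i) (D.h i)).submatrix
    ⇑D.equiv.symm ⇑D.equiv.symm

/-- The distance `|x, x'| = Σ_{i : xᵢ > x'ᵢ} (xᵢ − x'ᵢ)` between two tuples. -/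
def tdist {n : ℕ} (x x' : Fin n → ℚ) : ℚ := ∑ i, max (x i - x' i) 0

section Abstract

set_option linter.unusedSectionVars false

variable {R F : Type*} [CommRing R] [Field F] [Algebra R F]

/-- `x ∈ ϖ^m R`. -/
def Ig (ϖ : R) (m : ℤ) (x : F) : Prop := ∃ w : R, x = (algebraMap R F ϖ) ^ m * algebraMap R F w

theorem Ig.zero (ϖ : R) (m : ℤ) : Ig ϖ m (0 : F) := ⟨0, by simp⟩

theorem Ig.add {ϖ : R} {m : ℤ} {x y : F} (hx : Ig ϖ m x) (hy : Ig ϖ m y) : Ig ϖ m (x + y) := by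
  obtain ⟨a, rfl⟩ := hx
  obtain ⟨b, rfl⟩ := hy
  exact ⟨a + b, by rw [map_add]; ring⟩

variable [IsDomain R] [IsDiscreteValuationRing R] [IsFractionRing R F]

theorem pi_ne {ϖ : R} (hϖ : Irreducible ϖ) : algebraMap R F ϖ ≠ 0 := by
  intro h
  exact hϖ.ne_zero ((IsFractionRing.injective R F) (by simpa using h))

theorem Ig.mul {ϖ : R} (hϖ : Irreducible ϖ) {m m' : ℤ} {x y : F} (hx : Ig ϖ m x) (hy : Ig ϖ m' y) :
    Ig ϖ (m + m') (x * y) := by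
  obtain ⟨a, rfl⟩ := hx
  obtain ⟨b, rfl⟩ := hy
  exact ⟨a * b, by rw [map_mul, zpow_add₀ (pi_ne hϖ)]; ring⟩

theorem Ig.sum {ϖ : R} {m : ℤ} {ι : Type*} (s : Finset ι) (f : ι → F) (h : ∀ i ∈ s, Ig ϖ m (f i)) :
    Ig ϖ m (∑ i ∈ s, f i) :=
  Finset.sum_induction f (Ig ϖ m) (fun _ _ => Ig.add) (Ig.zero ϖ m) h

theorem Ig.zpow (ϖ : R) (m : ℤ) : Ig ϖ m ((algebraMap R F ϖ) ^ m) := ⟨1, by simp⟩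

theorem Ig.of_alg (ϖ w : R) : Ig ϖ 0 (algebraMap R F w) := ⟨w, by simp⟩

theorem Ig.mono {ϖ : R} (hϖ : Irreducible ϖ) {m m' : ℤ} (h : m' ≤ m) {x : F} (hx : Ig ϖ m x) :
    Ig ϖ m' x := by
  obtain ⟨a, rfl⟩ := hx
  obtain ⟨t, rfl⟩ := Int.le.dest h
  refine ⟨ϖ ^ t * a, ?_⟩
  rw [_root_.zpow_add₀ (pi_ne hϖ), map_mul, map_pow, zpow_natCast]
  ring

theorem Ig.exists {ϖ : R} (hϖ : Irreducible ϖ) (x : F) : ∃ m : ℤ, Ig ϖ m x := by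
  obtain ⟨a, b, hb, rfl⟩ := IsFractionRing.div_surjective (A := R) x
  obtain ⟨t, u, rfl⟩ := IsDiscreteValuationRing.eq_unit_mul_pow_irreducible
    (nonZeroDivisors.ne_zero hb) hϖ
  refine ⟨-t, a * ((u⁻¹ : Rˣ) : R), ?_⟩
  have hu : algebraMap R F (u : R) * algebraMap R F ((u⁻¹ : Rˣ) : R) = 1 := by
    rw [← map_mul]; simp
  have hu0 : algebraMap R F (u : R) ≠ 0 := left_ne_zero_of_mul_eq_one hu
  have h0 := pi_ne (F := F) hϖ
  rw [map_mul, map_mul, map_pow, _root_.zpow_neg, zpow_natCast]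
  field_simp
  linear_combination (-algebraMap R F a) * hu

theorem Ig.sep {ϖ : R} (hϖ : Irreducible ϖ) (x : F) (m : ℤ) (h : ∀ t : ℕ, Ig ϖ (m + t) x) :
    x = 0 := by
  obtain ⟨a, ha⟩ := h 0
  by_contra hx
  have h0 := pi_ne (F := F) hϖ
  have hdvd : ∀ t : ℕ, ϖ ^ t ∣ a := by
    intro t
    obtain ⟨c, hc⟩ := h t
    refine ⟨c, (IsFractionRing.injective R F) ?_⟩
    rw [hc, zpow_add₀ h0] at ha
    have h1 : (algebraMap R F ϖ) ^ m ≠ 0 := zpow_ne_zero _ h0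
    apply mul_left_cancel₀ h1
    simp only [Nat.cast_zero, add_zero, zpow_natCast] at ha
    rw [map_mul, map_pow, ← mul_assoc]
    exact ha.symm
  have ha0 : a ≠ 0 := by
    rintro rfl
    apply hx
    simpa using ha
  obtain ⟨t, u, rfl⟩ := IsDiscreteValuationRing.eq_unit_mul_pow_irreducible ha0 hϖ
  have := hdvd (t + 1)
  rw [mul_comm, Units.dvd_mul_right, pow_dvd_pow_iff hϖ.ne_zero hϖ.not_isUnit] at this
  omega

/-- the lattice `ϖ^m R^n`. -/
def Lam (F : Type*) [Field F] [Algebra R F] (n : ℕ) (ϖ : R) (m : ℤ) :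
    Submodule R (Fin n → F) where
  carrier := {x | ∀ i, Ig ϖ m (x i)}
  zero_mem' := fun _ => Ig.zero ϖ m
  add_mem' := fun hx hy i => (hx i).add (hy i)
  smul_mem' := by
    intro c x hx i
    obtain ⟨w, hw⟩ := hx i
    exact ⟨c * w, by rw [Pi.smul_apply, Algebra.smul_def, hw, map_mul]; ring⟩

variable {n : ℕ}

theorem mem_Lam {ϖ : R} {m : ℤ} {x : Fin n → F} : x ∈ Lam F n ϖ m ↔ ∀ i, Ig ϖ m (x i) := Iff.rfl

theorem Lam_mono {ϖ : R} (hϖ : Irreducible ϖ) {m m' : ℤ} (h : m' ≤ m) :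
    Lam F n ϖ m ≤ Lam F n ϖ m' := fun _ hx i => (hx i).mono hϖ h

theorem zpow_smul_mem {ϖ : R} (hϖ : Irreducible ϖ) {m : ℤ} (h : ℤ) {x : Fin n → F}
    (hx : x ∈ Lam F n ϖ m) : (algebraMap R F ϖ) ^ h • x ∈ Lam F n ϖ (m + h) := by
  intro i
  have := (Ig.zpow (F := F) ϖ h).mul hϖ (hx i)
  rw [add_comm] at this
  exact this

theorem of_zpow_smul_mem {ϖ : R} (hϖ : Irreducible ϖ) {m : ℤ} (h : ℤ) {x : Fin n → F}
    (hx : (algebraMap R F ϖ) ^ h • x ∈ Lam F n ϖ m) : x ∈ Lam F n ϖ (m - h) := by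
  have := zpow_smul_mem hϖ (-h) hx
  rwa [smul_smul, ← zpow_add₀ (pi_ne hϖ), neg_add_cancel, zpow_zero, one_smul] at this

theorem exists_mat_lower {ϖ : R} (hϖ : Irreducible ϖ) {ι : Type*} [Finite ι] (A : ι → F) :
    ∃ a : ℕ, ∀ i, Ig ϖ (-(a : ℤ)) (A i) := by
  have := Fintype.ofFinite ι
  choose f hf using fun i => Ig.exists (R := R) hϖ (A i)
  refine ⟨∑ i, (f i).natAbs, fun i => (hf i).mono hϖ ?_⟩
  have : (f i).natAbs ≤ ∑ i, (f i).natAbs :=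
    Finset.single_le_sum (f := fun i => (f i).natAbs) (fun _ _ => Nat.zero_le _) (Finset.mem_univ i)
  omega

theorem exists_mem_Lam {ϖ : R} (hϖ : Irreducible ϖ) (x : Fin n → F) : ∃ m : ℤ, x ∈ Lam F n ϖ m := by
  obtain ⟨a, ha⟩ := exists_mat_lower hϖ x
  exact ⟨_, ha⟩

theorem Lam_sep {ϖ : R} (hϖ : Irreducible ϖ) {x : Fin n → F} (hx : x ≠ 0) (a c : ℤ)
    (h : ∀ m : ℤ, x ∈ Lam F n ϖ m → x ∈ Lam F n ϖ (m + a - c)) : a ≤ c := by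
  by_contra hlt
  apply hx
  obtain ⟨m, hm⟩ := exists_mem_Lam hϖ x
  have key : ∀ t : ℕ, x ∈ Lam F n ϖ (m + t) := by
    intro t
    induction t with
    | zero => simpa using hm
    | succ t ih => exact Lam_mono hϖ (by push_cast; omega) (h _ ih)
  ext i
  exact Ig.sep hϖ (x i) m fun t => key t i

theorem mulVec_mem {ϖ : R} (hϖ : Irreducible ϖ) {A : Matrix (Fin n) (Fin n) F} {a m : ℤ}
    (hA : ∀ i j, Ig ϖ a (A i j)) {x : Fin n → F} (hx : x ∈ Lam F n ϖ m) :
    A *ᵥ x ∈ Lam F n ϖ (m + a) := by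
  intro i
  rw [Matrix.mulVec, dotProduct]
  apply Ig.sum
  intro j _
  rw [add_comm]
  exact (hA i j).mul hϖ (hx j)

theorem exists_mulVec_lower {ϖ : R} (hϖ : Irreducible ϖ) (A : Matrix (Fin n) (Fin n) F) :
    ∃ a : ℕ, ∀ m : ℤ, ∀ x ∈ Lam F n ϖ m, A *ᵥ x ∈ Lam F n ϖ (m - a) := by
  obtain ⟨a, ha⟩ := exists_mat_lower hϖ (fun ij : Fin n × Fin n => A ij.1 ij.2)
  exact ⟨a, fun m x hx => mulVec_mem hϖ (fun i j => ha (i, j)) hx⟩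

/-- integral unit matrices. -/
def IU (R : Type*) {F : Type*} [CommRing R] [Field F] [Algebra R F] {n : ℕ}
    (c : Matrix (Fin n) (Fin n) F) : Prop :=
  ∃ d : Matrix (Fin n) (Fin n) R, IsUnit d.det ∧ c = d.map (algebraMap R F)

theorem IU.mulVec_mem {ϖ : R} (hϖ : Irreducible ϖ) {c : Matrix (Fin n) (Fin n) F} (hc : IU R c)
    {m : ℤ} {x : Fin n → F} (hx : x ∈ Lam F n ϖ m) : c *ᵥ x ∈ Lam F n ϖ m := by
  obtain ⟨d, _, rfl⟩ := hc
  have := _root_.mulVec_mem hϖ (A := d.map (algebraMap R F)) (a := 0)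
    (fun i j => Ig.of_alg ϖ (d i j)) hx
  simpa using this

theorem IU.exists_inv {c : Matrix (Fin n) (Fin n) F} (hc : IU R c) :
    ∃ c', IU R c' ∧ c' * c = 1 ∧ c * c' = 1 := by
  obtain ⟨d, hd, rfl⟩ := hc
  refine ⟨d⁻¹.map (algebraMap R F), ⟨d⁻¹, Matrix.isUnit_nonsing_inv_det d hd, rfl⟩, ?_, ?_⟩
  · rw [← Matrix.map_mul, Matrix.nonsing_inv_mul d hd]; simp
  · rw [← Matrix.map_mul, Matrix.mul_nonsing_inv d hd]; simp

theorem IU.of_mulVec_mem {ϖ : R} (hϖ : Irreducible ϖ) {c : Matrix (Fin n) (Fin n) F} (hc : IU R c)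
    {m : ℤ} {x : Fin n → F} (hx : c *ᵥ x ∈ Lam F n ϖ m) : x ∈ Lam F n ϖ m := by
  obtain ⟨c', hc', h1, -⟩ := hc.exists_inv
  have := hc'.mulVec_mem hϖ hx
  rwa [Matrix.mulVec_mulVec, h1, Matrix.one_mulVec] at this

/-- primitive relation -/
theorem exists_primitive {ϖ : R} (hϖ : Irreducible ϖ) {N : ℕ} (a : Fin N → F) (ha : a ≠ 0) :
    ∃ (s : F) (w : Fin N → R), s ≠ 0 ∧ (∀ i, s * a i = algebraMap R F (w i)) ∧ ∃ i, IsUnit (w i) := by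
  have : ∃ m : ℤ, a ∈ Lam F N ϖ m ∧ a ∉ Lam F N ϖ (m + 1) := by
    by_contra hcon
    push Not at hcon
    have := Lam_sep hϖ ha 1 0 (fun m hm => by simpa using hcon m hm)
    omega
  obtain ⟨m, hm, hm'⟩ := this
  have h0 := pi_ne (F := F) hϖ
  choose w hw using hm
  refine ⟨(algebraMap R F ϖ) ^ (-m), w, zpow_ne_zero _ h0, ?_, ?_⟩
  · intro i
    rw [hw i, ← mul_assoc, ← zpow_add₀ h0]; simp
  · by_contra hcon
    push Not at hcon
    apply hm'
    intro i
    have : w i ∈ IsLocalRing.maximalIdeal R := (IsLocalRing.mem_maximalIdeal _).2 (hcon i)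
    rw [hϖ.maximalIdeal_eq, Ideal.mem_span_singleton] at this
    obtain ⟨c, hc⟩ := this
    refine ⟨c, ?_⟩
    rw [hw i, hc, map_mul, zpow_add₀ h0, zpow_one]; ring

/-- The Katz slope estimate. -/
theorem katz {ϖ : R} (hϖ : Irreducible ϖ) (G : (Fin n → F) →+ (Fin n → F))
    (hsm : ∀ w : R, ∃ w' : R, ∀ y, G (w • y) = w' • G y)
    (hp : ∀ y, G (ϖ • y) = ϖ • G y)
    (c0 : ℕ) (hc : ∀ m : ℤ, ∀ y ∈ Lam F n ϖ m, G y ∈ Lam F n ϖ (m - c0))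
    (x : Fin n → F) (c : ℤ) (hx : ∀ k : ℕ, G^[k] x ∈ Lam F n ϖ c) (m : ℤ)
    (hm : x ∈ Lam F n ϖ m) (k : ℕ) : G^[k] x ∈ Lam F n ϖ (m - n * c0) := by
  classical
  -- linear relation
  have hdep : ∃ a : Fin (n + 1) → F, a ≠ 0 ∧ ∑ i, a i • G^[(i : ℕ)] x = 0 := by
    have : ¬ LinearIndependent F (fun i : Fin (n + 1) => G^[(i : ℕ)] x) := by
      intro h
      have := h.fintype_card_le_finrank
      simp at this
    rw [Fintype.not_linearIndependent_iff] at this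
    obtain ⟨a, h1, i, h2⟩ := this
    exact ⟨a, fun h => h2 (by simp [h]), h1⟩
  obtain ⟨a, ha, hrel⟩ := hdep
  obtain ⟨s, w, hs, hw, hu⟩ := exists_primitive hϖ a ha
  have hrel' : ∑ i, w i • G^[(i : ℕ)] x = 0 := by
    have : s • ∑ i, a i • G^[(i : ℕ)] x = 0 := by rw [hrel, smul_zero]
    rw [Finset.smul_sum] at this
    rw [← this]
    refine Finset.sum_congr rfl fun i _ => ?_
    rw [smul_smul, hw, algebraMap_smul]
  -- largest unit index
  obtain ⟨j, hj, hjmax⟩ := Finset.exists_max_image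
    (Finset.univ.filter fun i : Fin (n + 1) => IsUnit (w i)) id
    (by obtain ⟨i, hi⟩ := hu; exact ⟨i, by simpa using hi⟩)
  simp only [Finset.mem_filter, Finset.mem_univ, true_and, id] at hj hjmax
  let T : Submodule R (Fin n → F) :=
    Submodule.span R ({y | ∃ i < (j : ℕ), y = G^[i] x} ∪ {y | ∃ i, y = ϖ • G^[i] x})
  have hT1 : ∀ i < (j : ℕ), G^[i] x ∈ T := fun i hi => Submodule.subset_span (Or.inl ⟨i, hi, rfl⟩)
  have hT2 : ∀ i, ϖ • G^[i] x ∈ T := fun i => Submodule.subset_span (Or.inr ⟨i, rfl⟩)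
  have hTj : G^[(j : ℕ)] x ∈ T := by
    have h1 : w j • G^[(j : ℕ)] x ∈ T := by
      rw [← Finset.add_sum_erase _ _ (Finset.mem_univ j), add_eq_zero_iff_eq_neg] at hrel'
      rw [hrel']
      refine T.neg_mem (T.sum_mem fun i hi => ?_)
      have hij : i ≠ j := Finset.ne_of_mem_erase hi
      rcases lt_or_gt_of_ne hij with h | h
      · exact T.smul_mem _ (hT1 i h)
      · have hnu : ¬ IsUnit (w i) := fun h' => absurd (hjmax i h') (not_le.2 h)
        have : w i ∈ IsLocalRing.maximalIdeal R := (IsLocalRing.mem_maximalIdeal _).2 hnu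
        rw [hϖ.maximalIdeal_eq, Ideal.mem_span_singleton] at this
        obtain ⟨c, hc⟩ := this
        rw [hc, mul_comm, mul_smul]
        exact T.smul_mem _ (hT2 i)
    obtain ⟨u, hu'⟩ := hj
    have h2 := T.smul_mem ((u⁻¹ : Rˣ) : R) h1
    rwa [smul_smul, ← hu', Units.inv_mul, one_smul] at h2
  have hTG : ∀ y ∈ T, G y ∈ T := by
    intro y hy
    induction hy using Submodule.span_induction with
    | mem y hy =>
      rcases hy with ⟨i, hi, rfl⟩ | ⟨i, rfl⟩
      · rw [← Function.iterate_succ_apply' G]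
        rcases Nat.lt_or_ge (i + 1) j with h | h
        · exact hT1 _ h
        · have : i + 1 = j := by omega
          rw [Nat.succ_eq_add_one, this]; exact hTj
      · rw [hp, ← Function.iterate_succ_apply' G]
        exact hT2 _
    | zero => rw [map_zero]; exact T.zero_mem
    | add y z _ _ h1 h2 => rw [map_add]; exact T.add_mem h1 h2
    | smul r y _ h =>
      obtain ⟨w', hw'⟩ := hsm r
      rw [hw']; exact T.smul_mem _ h
  have hTx : x ∈ T := by
    rcases Nat.eq_zero_or_pos (j : ℕ) with h | h
    · rw [h] at hTj; exact hTj
    · exact hT1 0 h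
  have hTall : ∀ i, G^[i] x ∈ T := by
    intro i
    induction i with
    | zero => exact hTx
    | succ i ih => rw [Function.iterate_succ_apply']; exact hTG _ ih
  have hS : ∀ i : ℕ, G^[i] x ∈ Lam F n ϖ (m - i * c0) := by
    intro i
    induction i with
    | zero => simpa using hm
    | succ i ih =>
      rw [Function.iterate_succ_apply']
      have := hc _ _ ih
      convert this using 1
      push_cast; ring_nf
  -- improvement
  have himp : ∀ t : ℕ, ∀ i, G^[i] x ∈ Lam F n ϖ (min (m - n * c0) (c + t)) := by
    intro t
    induction t with
    | zero => intro i; exact Lam_mono hϖ (by simp) (hx i)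
    | succ t ih =>
      intro i
      suffices h : T ≤ Lam F n ϖ (min (m - n * c0) (c + (t + 1 : ℕ))) from h (hTall i)
      apply Submodule.span_le.2
      rintro y (⟨i, hi, rfl⟩ | ⟨i, rfl⟩)
      · refine Lam_mono hϖ (le_trans (min_le_left _ _) ?_) (hS i)
        have : (i : ℤ) * c0 ≤ n * c0 := by
          have := j.2
          exact mul_le_mul_of_nonneg_right (by omega) (by positivity)
        omega
      · have := zpow_smul_mem hϖ 1 (ih i)
        rw [_root_.zpow_one, algebraMap_smul] at this
        refine Lam_mono hϖ ?_ this
        push_cast; omega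
  refine Lam_mono hϖ ?_ (himp (m - n * c0 - c).toNat k)
  have := Int.self_le_toNat (m - n * c0 - c)
  omega

theorem exists_kernel (A B : Matrix (Fin n) (Fin n) F) (i0 : Fin n) :
    ∃ y, y ≠ 0 ∧ (∀ j < i0, (A *ᵥ y) j = 0) ∧ ∀ j, i0 < j → (B *ᵥ y) j = 0 := by
  let M : Matrix (Fin n) (Fin n) F := fun j => if j < i0 then A j else if i0 < j then B j else 0
  have hdet : M.det = 0 := by
    apply Matrix.det_eq_zero_of_row_eq_zero i0
    intro j
    simp [M]
  obtain ⟨y, hy, hM⟩ := Matrix.exists_mulVec_eq_zero_iff.2 hdet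
  refine ⟨y, hy, fun j hj => ?_, fun j hj => ?_⟩
  · have := congrFun hM j
    simpa [Matrix.mulVec, M, hj] using this
  · have := congrFun hM j
    simpa [Matrix.mulVec, M, hj, not_lt.2 hj.le] using this


/-- automorphisms of `F` preserving `R` and fixing `ϖ`. -/
def Pres (ϖ : R) (σ : F ≃+* F) : Prop :=
  (∀ w : R, ∃ w' : R, σ (algebraMap R F w) = algebraMap R F w') ∧
    σ (algebraMap R F ϖ) = algebraMap R F ϖ

theorem Pres.pow {ϖ : R} {σ : F ≃+* F} (h : Pres ϖ σ) (k : ℕ) : Pres ϖ (σ ^ k : F ≃+* F) := by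
  induction k with
  | zero => exact ⟨fun w => ⟨w, rfl⟩, rfl⟩
  | succ k ih =>
    rw [pow_succ']
    refine ⟨fun w => ?_, ?_⟩
    · obtain ⟨w1, h1⟩ := ih.1 w
      obtain ⟨w2, h2⟩ := h.1 w1
      exact ⟨w2, by rw [RingAut.mul_apply, h1, h2]⟩
    · rw [RingAut.mul_apply, ih.2, h.2]

theorem Pres.ig {ϖ : R} {σ : F ≃+* F} (h : Pres ϖ σ) {m : ℤ} {x : F} (hx : Ig ϖ m x) :
    Ig ϖ m (σ x) := by
  obtain ⟨w, rfl⟩ := hx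
  obtain ⟨w', hw'⟩ := h.1 w
  exact ⟨w', by rw [map_mul, map_zpow₀, h.2, hw']⟩

/-- Cartan decomposition data -/
def Cartan (ϖ : R) (b c₁ c₂ : Matrix (Fin n) (Fin n) F) (μ : Fin n → ℤ) : Prop :=
  IU R c₁ ∧ IU R c₂ ∧ b = c₁ * Matrix.diagonal (fun i => (algebraMap R F ϖ) ^ (μ i)) * c₂

theorem Cartan.of_mem {ϖ : R} (hϖ : Irreducible ϖ) {b c₁ c₂ : Matrix (Fin n) (Fin n) F}
    {μ : Fin n → ℤ} (h : Cartan ϖ b c₁ c₂ μ) {x : Fin n → F} {a m : ℤ}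
    (hx : b *ᵥ x ∈ Lam F n ϖ m) (ha : ∀ r, (c₂ *ᵥ x) r = 0 ∨ μ r ≤ a) :
    x ∈ Lam F n ϖ (m - a) := by
  obtain ⟨h1, h2, rfl⟩ := h
  rw [mul_assoc, ← Matrix.mulVec_mulVec, ← Matrix.mulVec_mulVec] at hx
  have hx := h1.of_mulVec_mem hϖ hx
  apply h2.of_mulVec_mem hϖ
  intro r
  rcases ha r with h0 | h0
  · rw [h0]; exact Ig.zero _ _
  · have h3 := hx r
    rw [Matrix.mulVec_diagonal] at h3
    have h4 := (Ig.zpow (F := F) ϖ (-μ r)).mul hϖ h3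
    rw [← mul_assoc, ← zpow_add₀ (pi_ne hϖ), neg_add_cancel, zpow_zero, one_mul] at h4
    exact h4.mono hϖ (by omega)

theorem Cartan.mem {ϖ : R} (hϖ : Irreducible ϖ) {b c₁ c₂ : Matrix (Fin n) (Fin n) F}
    {μ : Fin n → ℤ} (h : Cartan ϖ b c₁ c₂ μ) {x : Fin n → F} {a m : ℤ}
    (hx : x ∈ Lam F n ϖ m) (ha : ∀ r, (c₂ *ᵥ x) r = 0 ∨ a ≤ μ r) :
    b *ᵥ x ∈ Lam F n ϖ (m + a) := by
  obtain ⟨h1, h2, rfl⟩ := h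
  rw [mul_assoc, ← Matrix.mulVec_mulVec, ← Matrix.mulVec_mulVec]
  apply h1.mulVec_mem hϖ
  have h3 := h2.mulVec_mem hϖ hx
  intro r
  rw [Matrix.mulVec_diagonal]
  rcases ha r with h0 | h0
  · rw [h0, mul_zero]; exact Ig.zero _ _
  · exact ((Ig.zpow (F := F) ϖ (μ r)).mul hϖ (h3 r)).mono hϖ (by omega)

/-- the minimal side -/
theorem min_bound {ϖ : R} (hϖ : Irreducible ϖ) (B : Matrix (Fin n) (Fin n) F) (N : ℕ)
    (hN : 0 < N) (e : Fin n → ℤ) (he : Antitone e)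
    (hB : B ^ N = Matrix.diagonal (fun j => (algebraMap R F ϖ) ^ (e j))) :
    ∃ C : ℕ, ∀ (k : ℕ) (c₁ c₂ : Matrix (Fin n) (Fin n) F) (μ : Fin n → ℤ), Antitone μ →
      Cartan ϖ (B ^ k) c₁ c₂ μ → ∀ i, (k / N : ℕ) * e i - C ≤ μ i := by
  obtain ⟨a, ha⟩ := exists_mulVec_lower hϖ B
  refine ⟨N * a, fun k c₁ c₂ μ hμ hc i => ?_⟩
  obtain ⟨x, hx0, h1, h2⟩ := exists_kernel c₂ (1 : Matrix (Fin n) (Fin n) F) i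
  simp only [Matrix.one_mulVec] at h2
  have hpow : ∀ t : ℕ, ∀ m : ℤ, ∀ y ∈ Lam F n ϖ m, (B ^ t) *ᵥ y ∈ Lam F n ϖ (m - t * a) := by
    intro t
    induction t with
    | zero => intro m y hy; simpa using hy
    | succ t ih =>
      intro m y hy
      rw [pow_succ', ← Matrix.mulVec_mulVec]
      refine Lam_mono hϖ ?_ (ha _ _ (ih m y hy))
      push_cast; linarith
  suffices h : (k / N : ℕ) * e i ≤ N * a + μ i by rw [Nat.cast_mul]; linarith
  apply Lam_sep hϖ hx0
  intro m hm
  have hq : (B ^ (N * (k / N))) *ᵥ x ∈ Lam F n ϖ (m + (k / N : ℕ) * e i) := by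
    rw [pow_mul, hB, Matrix.diagonal_pow]
    intro j
    rw [Matrix.mulVec_diagonal]
    rcases lt_or_ge i j with hij | hij
    · rw [h2 j hij, mul_zero]; exact Ig.zero _ _
    · have h3 := (Ig.zpow (F := F) ϖ ((k / N : ℕ) * e j)).mul hϖ (hm j)
      rw [mul_comm ((k / N : ℕ) : ℤ), _root_.zpow_mul, zpow_natCast] at h3
      refine Ig.mono hϖ ?_ h3
      have : ((k / N : ℕ) : ℤ) * e i ≤ (k / N : ℕ) * e j :=
        mul_le_mul_of_nonneg_left (he hij) (by positivity)
      linarith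
  have ht := hpow (k % N) _ _ hq
  rw [Matrix.mulVec_mulVec, ← pow_add, Nat.mod_add_div] at ht
  have hfin := hc.of_mem hϖ ht (a := μ i) (fun r => by
    rcases lt_or_ge r i with h | h
    · exact Or.inl (h1 r h)
    · exact Or.inr (hμ h))
  refine Lam_mono hϖ ?_ hfin
  have h5 : ((k % N : ℕ) : ℤ) * a ≤ N * a :=
    mul_le_mul_of_nonneg_right (by exact_mod_cast (Nat.mod_lt k hN).le) (by positivity)
  linarith

theorem map_mulVec_ring (τ : F ≃+* F) (A : Matrix (Fin n) (Fin n) F) (y : Fin n → F) :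
    (fun j => τ ((A *ᵥ y) j)) = A.map τ *ᵥ (fun j => τ (y j)) := by
  ext j
  simp [Matrix.mulVec, dotProduct, map_sum]

/-- The `b` side. -/
theorem b_bound {ϖ : R} (hϖ : Irreducible ϖ) (σ : F ≃+* F) (hσ : Pres ϖ σ)
    (hσ' : Pres ϖ (σ⁻¹ : F ≃+* F)) (B : Matrix (Fin n) (Fin n) F) (hBσ : B.map σ = B) (N : ℕ)
    (hN : 0 < N) (e : Fin n → ℤ) (he : Antitone e)
    (hB : B ^ N = Matrix.diagonal (fun j => (algebraMap R F ϖ) ^ (e j)))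
    (E : ℕ) (hE : ∀ j, |e j| ≤ E) (a : ℕ) (μ : Fin n → ℤ) (hμa : ∀ i, μ i ≤ a)
    (b g d₁ d₂ : Matrix (Fin n) (Fin n) F) (hb : IsUnit b.det) (hg : IsUnit g.det)
    (hbμ : Cartan ϖ b d₁ d₂ μ) (hbg : b = g⁻¹ * B * g.map σ)
    (tp : ℕ → Matrix (Fin n) (Fin n) F) (htp0 : tp 0 = 1)
    (htp : ∀ k, tp (k + 1) = b * (tp k).map σ)
    (k : ℕ) (c₁ c₂ : Matrix (Fin n) (Fin n) F) (μk : Fin n → ℤ) (hμk : Antitone μk)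
    (hk : Cartan ϖ (tp k) c₁ c₂ μk) (i : Fin n) :
    μk i ≤ (k / N : ℕ) * e i + (n * (N * a + E) + N * a : ℕ) := by
  have hπ0 := pi_ne (F := F) hϖ
  set π : F := algebraMap R F ϖ with hπ
  let Φ : (Fin n → F) → (Fin n → F) := fun y => b *ᵥ (fun j => σ (y j))
  let Ψ : AddMonoid.End (Fin n → F) :=
    { toFun := fun y j => (σ⁻¹ : F ≃+* F) ((b⁻¹ *ᵥ y) j)
      map_zero' := by ext j; simp
      map_add' := by intro y z; ext j; simp [Matrix.mulVec_add] }
  have hΨ : ∀ y j, Ψ y j = (σ⁻¹ : F ≃+* F) ((b⁻¹ *ᵥ y) j) := fun y j => rfl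
  have hσσ : ∀ x, (σ⁻¹ : F ≃+* F) (σ x) = x := fun x => σ.symm_apply_apply x
  have hσσ' : ∀ x, σ ((σ⁻¹ : F ≃+* F) x) = x := fun x => σ.apply_symm_apply x
  have hΨΦ : ∀ y, Ψ (Φ y) = y := by
    intro y
    ext j
    rw [hΨ]
    simp only [Φ]
    rw [Matrix.mulVec_mulVec, Matrix.nonsing_inv_mul _ hb, Matrix.one_mulVec, hσσ]
  have hΦΨ : ∀ y, Φ (Ψ y) = y := by
    intro y
    simp only [Φ, hΨ, hσσ']
    rw [Matrix.mulVec_mulVec, Matrix.mul_nonsing_inv _ hb, Matrix.one_mulVec]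
  have hΨΦN : ∀ t y, (Ψ ^ t) (Φ^[t] y) = y := by
    intro t y
    rw [AddMonoid.End.coe_pow]
    exact Function.LeftInverse.iterate hΨΦ t y
  have hΦΨN : ∀ t y, Φ^[t] ((Ψ ^ t) y) = y := by
    intro t y
    rw [AddMonoid.End.coe_pow]
    exact Function.LeftInverse.iterate hΦΨ t y
  -- bound for Ψ
  have hΨb : ∀ m : ℤ, ∀ y ∈ Lam F n ϖ m, Ψ y ∈ Lam F n ϖ (m - a) := by
    intro m y hy j
    have h1 : b *ᵥ (b⁻¹ *ᵥ y) ∈ Lam F n ϖ m := by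
      rwa [Matrix.mulVec_mulVec, Matrix.mul_nonsing_inv _ hb, Matrix.one_mulVec]
    exact hσ'.ig (hbμ.of_mem hϖ h1 (fun r => Or.inr (hμa r)) j)
  have hΨbt : ∀ t : ℕ, ∀ m : ℤ, ∀ y ∈ Lam F n ϖ m, (Ψ ^ t) y ∈ Lam F n ϖ (m - t * a) := by
    intro t
    induction t with
    | zero => intro m y hy; simpa using hy
    | succ t ih =>
      intro m y hy
      rw [pow_succ', AddMonoid.End.coe_mul, Function.comp_apply]
      refine Lam_mono hϖ ?_ (hΨb _ _ (ih m y hy))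
      push_cast; linarith
  have hΨs : ∀ t : ℕ, ∀ (s : F) (y : Fin n → F),
      (Ψ ^ t) (s • y) = ((σ⁻¹ : F ≃+* F) ^ t) s • (Ψ ^ t) y := by
    intro t
    induction t with
    | zero => intro s y; simp
    | succ t ih =>
      intro s y
      rw [pow_succ', AddMonoid.End.coe_mul, Function.comp_apply, ih, Function.comp_apply]
      ext j
      rw [hΨ, Matrix.mulVec_smul, Pi.smul_apply, Pi.smul_apply, hΨ, smul_eq_mul, map_mul,
        smul_eq_mul, pow_succ', RingAut.mul_apply]
  -- coordinates
  have hBσt : ∀ t : ℕ, (B ^ t).map σ = B ^ t := by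
    intro t
    induction t with
    | zero => simp
    | succ t ih => rw [pow_succ, Matrix.map_mul, ih, hBσ]
  have hgΦ : ∀ t : ℕ, ∀ y, g *ᵥ (Φ^[t] y) = (B ^ t) *ᵥ fun j => (σ ^ t : F ≃+* F) ((g *ᵥ y) j) := by
    intro t
    induction t with
    | zero => intro y; simp
    | succ t ih =>
      intro y
      rw [Function.iterate_succ_apply']
      have h1 : g *ᵥ Φ (Φ^[t] y) = B *ᵥ fun j => σ ((g *ᵥ (Φ^[t] y)) j) := by
        simp only [Φ]
        rw [map_mulVec_ring, Matrix.mulVec_mulVec, Matrix.mulVec_mulVec, show g * b = B * g.map σ from by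
          rw [hbg, mul_assoc, ← mul_assoc g, Matrix.mul_nonsing_inv _ hg, one_mul]]
      rw [h1, ih, map_mulVec_ring, hBσt, Matrix.mulVec_mulVec, ← pow_succ']
      congr 1
      ext j
      rw [pow_succ' σ, RingAut.mul_apply]
  have hgΦN : ∀ q : ℕ, ∀ y j, (g *ᵥ (Φ^[N * q] y)) j =
      π ^ ((q : ℤ) * e j) * (σ ^ (N * q) : F ≃+* F) ((g *ᵥ y) j) := by
    intro q y j
    rw [hgΦ, pow_mul, hB, Matrix.diagonal_pow, Matrix.mulVec_diagonal, mul_comm (q : ℤ), _root_.zpow_mul,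
      zpow_natCast, Pi.pow_apply]
  have htpΦ : ∀ t : ℕ, ∀ y, tp t *ᵥ (fun j => (σ ^ t : F ≃+* F) (y j)) = Φ^[t] y := by
    intro t
    induction t with
    | zero => intro y; rw [htp0]; simp
    | succ t ih =>
      intro y
      rw [Function.iterate_succ_apply', ← ih, htp, ← Matrix.mulVec_mulVec]
      simp only [Φ]
      rw [map_mulVec_ring]
      congr 2
      ext j
      rw [pow_succ' σ, RingAut.mul_apply]
  -- the operator `G`
  let h : ℤ := e i
  let G : (Fin n → F) →+ (Fin n → F) :=
    (DistribSMul.toAddMonoidHom (Fin n → F) (π ^ h)).comp (Ψ ^ N)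
  have hG : ∀ y, G y = π ^ h • (Ψ ^ N) y := fun y => rfl
  have hτ : Pres ϖ ((σ⁻¹ : F ≃+* F) ^ N : F ≃+* F) := hσ'.pow N
  have hGs : ∀ (s : F) y, G (s • y) = ((σ⁻¹ : F ≃+* F) ^ N) s • G y := by
    intro s y
    rw [hG, hG, hΨs, smul_comm]
  have hGc : ∀ m : ℤ, ∀ y ∈ Lam F n ϖ m, G y ∈ Lam F n ϖ (m - (N * a + E : ℕ)) := by
    intro m y hy
    rw [hG]
    refine Lam_mono hϖ ?_ (zpow_smul_mem hϖ h (hΨbt N m y hy))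
    have := neg_le_of_abs_le (hE i)
    push_cast
    simp only [h]
    linarith
  have hGπ : ∀ q : ℕ, ∀ y, G^[q] (Φ^[N * q] y) = π ^ (h * q) • y := by
    intro q
    induction q with
    | zero => intro y; simp
    | succ q ih =>
      intro y
      rw [Function.iterate_succ_apply', Nat.mul_succ, Function.iterate_add_apply, ih, hGs, hG,
        hΨΦN, map_zpow₀, hτ.2, smul_smul, ← zpow_add₀ hπ0]
      congr 2
      push_cast; ring
  have hGcoord : ∀ y j, (g *ᵥ G y) j = π ^ (h - e j) * ((σ⁻¹ : F ≃+* F) ^ N) ((g *ᵥ y) j) := by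
    intro y j
    have h1 := hgΦN 1 ((Ψ ^ N) y) j
    rw [mul_one, hΦΨN] at h1
    rw [h1, hG, Matrix.mulVec_smul, Pi.smul_apply, smul_eq_mul, map_mul, map_zpow₀, hτ.2, inv_pow,
      ← RingAut.mul_apply, inv_mul_cancel, RingAut.one_apply, ← mul_assoc, ← zpow_add₀ hπ0]
    congr 2
    push_cast; ring
  -- boundedness of orbits
  have hGbd : ∀ u : Fin n → F, (∀ j, h < e j → (g *ᵥ u) j = 0) →
      ∃ c : ℤ, ∀ q : ℕ, G^[q] u ∈ Lam F n ϖ c := by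
    intro u hu
    obtain ⟨m, hm⟩ := exists_mem_Lam hϖ (g *ᵥ u)
    obtain ⟨ag, hag⟩ := exists_mulVec_lower hϖ g⁻¹
    refine ⟨m - ag, fun q => ?_⟩
    have key : g *ᵥ (G^[q] u) ∈ Lam F n ϖ m ∧ ∀ j, h < e j → (g *ᵥ (G^[q] u)) j = 0 := by
      induction q with
      | zero => exact ⟨hm, hu⟩
      | succ q ih =>
        rw [Function.iterate_succ_apply']
        refine ⟨fun j => ?_, fun j hj => ?_⟩
        · rw [hGcoord]
          rcases lt_or_ge h (e j) with hj | hj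
          · rw [ih.2 j hj, map_zero, mul_zero]; exact Ig.zero _ _
          · exact ((Ig.zpow ϖ (h - e j)).mul hϖ (hτ.ig (ih.1 j))).mono hϖ (by omega)
        · rw [hGcoord, ih.2 j hj, map_zero, mul_zero]
    have := hag _ _ key.1
    rwa [Matrix.mulVec_mulVec, Matrix.nonsing_inv_mul _ hg, Matrix.one_mulVec] at this
  -- the test vector
  obtain ⟨y, hy0, hy1, hy2⟩ := exists_kernel (g.map (σ ^ k : F ≃+* F)) c₂ i
  let x : Fin n → F := fun j => (σ ^ k : F ≃+* F).symm (y j)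
  have hxy : (fun j => (σ ^ k : F ≃+* F) (x j)) = y := by
    ext j; simp [x]
  have hx0 : x ≠ 0 := by
    intro hx
    apply hy0
    rw [← hxy, hx]
    ext j; simp
  have hxg : ∀ j, h < e j → (g *ᵥ x) j = 0 := by
    intro j hj
    have hji : j < i := by
      by_contra hcon
      exact absurd (he (not_lt.1 hcon)) (not_le.2 hj)
    have h1 := hy1 j hji
    rw [← hxy, ← map_mulVec_ring] at h1
    exact (map_eq_zero_iff _ (σ ^ k : F ≃+* F).injective).1 h1
  have hkd : k % N + N * (k / N) = k := Nat.mod_add_div k N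
  suffices hmain : μk i ≤ (n * (N * a + E) + N * a : ℕ) + h * (k / N : ℕ) by
    simp only [h] at hmain; linarith
  apply Lam_sep hϖ hx0
  intro m hm
  have s1 : y ∈ Lam F n ϖ m := by
    rw [← hxy]; exact fun j => (hσ.pow k).ig (hm j)
  have s2 := hk.mem hϖ s1 (a := μk i) (fun r => by
    rcases lt_or_ge i r with h | h
    · exact Or.inl (hy2 r h)
    · exact Or.inr (hμk h))
  rw [← hxy, htpΦ] at s2
  set u := Φ^[N * (k / N)] x with hu
  have s3 : Φ^[k] x = Φ^[k % N] u := by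
    rw [hu, ← Function.iterate_add_apply, hkd]
  rw [s3] at s2
  have s4 := hΨbt (k % N) _ _ s2
  rw [hΨΦN] at s4
  have hug : ∀ j, h < e j → (g *ᵥ u) j = 0 := by
    intro j hj
    rw [hu, hgΦN, hxg j hj, map_zero, mul_zero]
  obtain ⟨c, hc⟩ := hGbd u hug
  have s5 := katz hϖ G
    (fun w => by
      obtain ⟨w', hw'⟩ := hτ.1 w
      refine ⟨w', fun y => ?_⟩
      rw [← algebraMap_smul F w y, hGs, hw', algebraMap_smul])
    (fun y => by rw [← algebraMap_smul F ϖ y, hGs, hτ.2, algebraMap_smul])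
    (N * a + E) hGc u c hc _ s4 (k / N)
  rw [hu, hGπ] at s5
  have s6 := of_zpow_smul_mem hϖ _ s5
  refine Lam_mono hϖ ?_ s6
  have h5 : ((k % N : ℕ) : ℤ) * a ≤ N * a :=
    mul_le_mul_of_nonneg_right (by exact_mod_cast (Nat.mod_lt k hN).le) (by positivity)
  push_cast
  push_cast at h5
  linarith

end Abstract

theorem p_ne : (p : K) ≠ 0 := by
  have h := pi_ne (F := K) (WittVector.irreducible p (k := κ))
  rwa [map_natCast] at h

theorem Bmat_mul (m : ℕ) (hm : 0 < m) (h h' : ℤ) :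
    Bmat p κ m h * Bmat p κ m h' = Bmat p κ m (h + h') := by
  have hp0 : (p : K) ≠ 0 := p_ne p κ
  have hm' : (0 : ℤ) < m := by exact_mod_cast hm
  ext r j
  rw [Matrix.mul_apply]
  have hnn := Int.emod_nonneg ((j : ℤ) + h') hm'.ne'
  have hlt := Int.emod_lt_of_pos ((j : ℤ) + h') hm'
  let s0 : Fin m := ⟨(((j : ℤ) + h') % m).toNat, by omega⟩
  have hs0 : ((s0 : ℕ) : ℤ) = ((j : ℤ) + h') % m := by
    simp only [s0]; exact Int.toNat_of_nonneg hnn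
  rw [Finset.sum_eq_single s0]
  · have hdm := Int.emod_add_mul_ediv ((j : ℤ) + h') m
    have e1 : (j : ℤ) + (h + h') = ((s0 : ℕ) : ℤ) + h + m * (((j : ℤ) + h') / m) := by
      rw [hs0]; linarith
    have e2 : ((s0 : ℕ) : ℤ) % m = ((j : ℤ) + h') % m := by
      rw [hs0, Int.emod_emod_of_dvd _ (dvd_refl _)]
    simp only [Bmat]
    rw [e1, Int.add_mul_emod_self_left, Int.add_mul_ediv_left _ _ hm'.ne', if_pos e2]
    split_ifs
    · rw [zpow_add₀ hp0]
    · rw [zero_mul]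
  · intro s _ hs
    have : ¬ ((s : ℕ) : ℤ) % m = ((j : ℤ) + h') % m := by
      intro hcon
      apply hs
      have h1 : ((s : ℕ) : ℤ) % m = s := Int.emod_eq_of_lt (by positivity) (by exact_mod_cast s.2)
      ext
      rw [← Int.natCast_inj, hs0, ← hcon, h1]
    simp only [Bmat]
    rw [if_neg this, mul_zero]
  · intro h; exact absurd (Finset.mem_univ _) h

theorem Bmat_mul_self (m : ℕ) (hm : 0 < m) (t : ℤ) :
    Bmat p κ m (m * t) = Matrix.diagonal (fun _ => (p : K) ^ t) := by
  have hm' : (0 : ℤ) < m := by exact_mod_cast hm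
  ext r j
  simp only [Bmat]
  have hr : ((r : ℕ) : ℤ) % m = r := Int.emod_eq_of_lt (by positivity) (by exact_mod_cast r.2)
  have hj : ((j : ℕ) : ℤ) % m = j := Int.emod_eq_of_lt (by positivity) (by exact_mod_cast j.2)
  have hj' : ((j : ℕ) : ℤ) / m = 0 := Int.ediv_eq_zero_of_lt (by positivity) (by exact_mod_cast j.2)
  rw [Int.add_mul_emod_self_left, Int.add_mul_ediv_left _ _ hm'.ne', hr, hj, hj', zero_add,
    Matrix.diagonal_apply]
  congr 1
  rw [Int.natCast_inj, Fin.ext_iff]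

theorem Bmat_pow (m : ℕ) (hm : 0 < m) (h : ℤ) (k : ℕ) :
    Bmat p κ m h ^ k = Bmat p κ m (k * h) := by
  induction k with
  | zero =>
    have := Bmat_mul_self p κ m hm 0
    rw [mul_zero] at this
    rw [Nat.cast_zero, zero_mul, this]
    simp
  | succ k ih =>
    rw [pow_succ, ih, Bmat_mul p κ m hm]
    congr 1
    push_cast; ring

/-- a common denominator of the slopes -/
def Nden {n : ℕ} (D : BlockData n) : ℕ := ∏ i, D.m i

theorem Nden_pos {n : ℕ} (D : BlockData n) : 0 < Nden D := Finset.prod_pos fun i _ => D.m_pos i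

/-- the exponents of `b_min ^ Nden` -/
def eexp {n : ℕ} (D : BlockData n) (j : Fin n) : ℤ :=
  (Nden D / D.m (D.equiv.symm j).1 : ℕ) * D.h (D.equiv.symm j).1

theorem Nden_div {n : ℕ} (D : BlockData n) (i : Fin D.len) : D.m i * (Nden D / D.m i) = Nden D :=
  Nat.mul_div_cancel' (Finset.dvd_prod_of_mem _ (Finset.mem_univ i))

theorem minMatrix_pow {n : ℕ} (D : BlockData n) :
    minMatrix p κ D ^ Nden D = Matrix.diagonal (fun j => (p : K) ^ eexp D j) := by
  have h1 : ∀ k : ℕ, minMatrix p κ D ^ k =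
      (Matrix.blockDiagonal' (fun i => Bmat p κ (D.m i) (D.h i)) ^ k).submatrix
        ⇑D.equiv.symm ⇑D.equiv.symm := by
    intro k
    induction k with
    | zero => simp
    | succ k ih => rw [pow_succ, ih, pow_succ, minMatrix, Matrix.submatrix_mul_equiv]
  rw [h1, ← Matrix.blockDiagonal'_pow]
  have h2 : (fun i => Bmat p κ (D.m i) (D.h i)) ^ Nden D =
      fun i => Matrix.diagonal (fun _ : Fin (D.m i) => (p : K) ^ ((Nden D / D.m i : ℕ) * D.h i)) := by
    funext i
    rw [Pi.pow_apply, Bmat_pow p κ _ (D.m_pos i), ← Bmat_mul_self p κ _ (D.m_pos i), ← mul_assoc,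
      ← Nat.cast_mul, Nden_div]
  rw [h2, Matrix.blockDiagonal'_diagonal, Matrix.submatrix_diagonal_equiv]
  rfl

theorem equiv_lt {n : ℕ} (D : BlockData n) (x y : Σ i : Fin D.len, Fin (D.m i)) (h : x.1 < y.1) :
    D.equiv x < D.equiv y := by
  rw [Fin.lt_def, D.equiv_val, D.equiv_val]
  have : (∑ j : Fin D.len, if j < x.1 then D.m j else 0) + D.m x.1 ≤
      ∑ j : Fin D.len, if j < y.1 then D.m j else 0 := by
    have h1 : D.m x.1 = ∑ j : Fin D.len, if j = x.1 then D.m j else 0 := by simp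
    rw [h1, ← Finset.sum_add_distrib]
    apply Finset.sum_le_sum
    intro j _
    rcases lt_trichotomy j x.1 with hj | hj | hj
    · rw [if_pos hj, if_neg hj.ne, if_pos (hj.trans h)]; simp
    · rw [if_neg (by rw [hj]; exact lt_irrefl _), if_pos hj, if_pos (hj ▸ h)]; simp
    · rw [if_neg hj.not_gt, if_neg hj.ne']; simp
  have := x.2.2
  omega

theorem eexp_antitone {n : ℕ} (D : BlockData n) : Antitone (eexp D) := by
  intro j j' hj
  have hle : (D.equiv.symm j).1 ≤ (D.equiv.symm j').1 := by
    by_contra hcon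
    have := equiv_lt D _ _ (not_le.1 hcon)
    simp only [Equiv.apply_symm_apply] at this
    exact absurd hj (not_le.2 this)
  have hs := D.slopes_antitone hle
  have key : ∀ i : Fin D.len, (((Nden D / D.m i : ℕ) * D.h i : ℤ) : ℚ) =
      Nden D * ((D.h i : ℚ) / D.m i) := by
    intro i
    have h0 : (D.m i : ℚ) ≠ 0 := by exact_mod_cast (D.m_pos i).ne'
    have h1 : (D.m i : ℚ) * ((Nden D / D.m i : ℕ) : ℚ) = Nden D := by exact_mod_cast Nden_div D i
    rw [Int.cast_mul, Int.cast_natCast, ← h1]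
    field_simp
  rw [← Int.cast_le (R := ℚ)]
  unfold eexp
  rw [key, key]
  exact mul_le_mul_of_nonneg_left hs (by positivity)

theorem minMatrix_map {n : ℕ} (D : BlockData n) (σ : K ≃+* K) :
    (minMatrix p κ D).map ⇑σ = minMatrix p κ D := by
  unfold minMatrix
  rw [← Matrix.submatrix_map, Matrix.blockDiagonal'_map _ _ (map_zero σ)]
  congr 2
  funext i
  ext r j
  simp only [Matrix.map_apply, Bmat]
  split_ifs
  · rw [map_zpow₀, map_natCast]
  · rw [map_zero]

theorem pres_of_frob (σ : K ≃+* K)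
    (hσ : ∀ x : 𝕎, σ (algebraMap 𝕎 K x) = algebraMap 𝕎 K (WittVector.frobenius x)) :
    Pres (p : 𝕎) σ ∧ Pres (p : 𝕎) (σ⁻¹ : K ≃+* K) := by
  refine ⟨⟨fun w => ⟨_, hσ w⟩, by rw [map_natCast, map_natCast]⟩,
    ⟨fun w => ?_, by rw [map_natCast, map_natCast]⟩⟩
  obtain ⟨w', rfl⟩ := (WittVector.frobenius_bijective p κ).2 w
  refine ⟨w', ?_⟩
  rw [← hσ]
  exact σ.symm_apply_apply _

theorem statement_10 (n : ℕ) (σ : K ≃+* K)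
    (hσ : ∀ x : 𝕎, σ (algebraMap 𝕎 K x) = algebraMap 𝕎 K (WittVector.frobenius x))
    (D : BlockData n) (μ : Fin n → ℤ) (hμanti : Antitone μ) :
    ∃ C : ℚ, 0 < C ∧
      ∀ b : Matrix (Fin n) (Fin n) K, IsUnit b.det → IsHodgePoint p κ b μ →
        (∃ g : Matrix (Fin n) (Fin n) K, IsUnit g.det ∧
          b = g⁻¹ * minMatrix p κ D * g.map ⇑σ) →
        ∀ k, 1 ≤ k → ∀ μk μmin : Fin n → ℤ,
          IsHodgePoint p κ (twistedPow p κ σ b k) μk →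
          IsHodgePoint p κ ((minMatrix p κ D) ^ k) μmin →
          tdist (fun i => (μk i : ℚ)) (fun i => (μmin i : ℚ)) < C := by
  have hϖ : Irreducible (p : 𝕎) := WittVector.irreducible p
  have hpc : algebraMap 𝕎 K (p : 𝕎) = (p : K) := map_natCast _ _
  obtain ⟨hσ1, hσ2⟩ := pres_of_frob p κ σ hσ
  have hB : minMatrix p κ D ^ Nden D =
      Matrix.diagonal (fun j => (algebraMap 𝕎 K (p : 𝕎)) ^ eexp D j) := by
    rw [hpc]; exact minMatrix_pow p κ D
  obtain ⟨C1, hC1⟩ := min_bound hϖ (minMatrix p κ D) (Nden D) (Nden_pos D) (eexp D)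
    (eexp_antitone D) hB
  let E : ℕ := ∑ j, (eexp D j).natAbs
  have hE : ∀ j, |eexp D j| ≤ E := by
    intro j
    rw [Int.abs_eq_natAbs, Int.ofNat_le]
    exact Finset.single_le_sum (f := fun j => (eexp D j).natAbs) (fun _ _ => Nat.zero_le _)
      (Finset.mem_univ j)
  let a : ℕ := ∑ j, (μ j).natAbs
  have ha : ∀ j, μ j ≤ a := by
    intro j
    refine le_trans Int.le_natAbs (Int.ofNat_le.2 ?_)
    exact Finset.single_le_sum (f := fun j => (μ j).natAbs) (fun _ _ => Nat.zero_le _)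
      (Finset.mem_univ j)
  let C : ℕ := (n * (Nden D * a + E) + Nden D * a) + C1
  refine ⟨n * C + 1, by positivity, ?_⟩
  rintro b hb ⟨-, d₁, d₂, hd₁, hd₂, hbd⟩ ⟨g, hg, hbg⟩ k - μk μmin ⟨hμk, c₁, c₂, hc₁, hc₂, hk⟩
    ⟨hμmin, c₁', c₂', hc₁', hc₂', hmin⟩
  have hle : ∀ i, μk i - μmin i ≤ C := by
    intro i
    have h1 := hC1 k c₁' c₂' μmin hμmin ⟨hc₁', hc₂', by rw [hpc]; exact hmin⟩ i
    have h2 := b_bound hϖ σ hσ1 hσ2 (minMatrix p κ D) (minMatrix_map p κ D σ) (Nden D) (Nden_pos D)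
      (eexp D) (eexp_antitone D) hB E hE a μ ha b g d₁ d₂ hb hg
      ⟨hd₁, hd₂, by rw [hpc]; exact hbd⟩ hbg (twistedPow p κ σ b) rfl (fun _ => rfl) k c₁ c₂ μk hμk
      ⟨hc₁, hc₂, by rw [hpc]; exact hk⟩ i
    simp only [C, Nat.cast_add] at h1 h2 ⊢
    linarith
  have hsum : tdist (fun i => (μk i : ℚ)) (fun i => (μmin i : ℚ)) ≤ n * C := by
    unfold tdist
    calc ∑ i, max ((μk i : ℚ) - μmin i) 0 ≤ ∑ _i : Fin n, (C : ℚ) := by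
          apply Finset.sum_le_sum
          intro i _
          refine max_le ?_ (by positivity)
          exact_mod_cast hle i
      _ = n * C := by simp
  linarith

end
end

section
/- Call R ∈ GL_2(L) a normal form if either R = diag(π^a, π^b) with integers a ≤ b, in which case its Newton slopes are {a, b}, or R = [[0, π^h],[1, 0]] with h an odd integer, in which case its Newton slopes are {h/2, h/2}. Suppose b, b' ∈ GL_2(L) satisfy b = c·R·σ(c)⁻¹ and b' = c'·R'·σ(c')⁻¹ for normal forms R, R' and c, c' ∈ GL_2(L). If μ(b) = μ(b') and μ(b·σ(b)) = μ(b'·σ(b')), then R and R' have the same multiset of Newton slopes. (In particular, every refined Hodge stratum H_{(μ¹,μ²),2}(GL_2) over K = Frac(W(k)) or over a totally ramified extension thereof lies in a single Newton stratum; this contains the theorem of Andreatta–Goren that the invariants (j, n) determine the Newton point.) -/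
/-!
Statement 13.  `L` is a field with a surjective discrete valuation
`v : L^× ↠ ℤ` (encoded by a function `v : L → ℤ`, multiplicative on nonzero
elements and satisfying the ultrametric inequality, with a uniformizer `π`,
`v π = 1`), and `σ` a ring automorphism of `L` with `v ∘ σ = v` and `σ π = π`.
`GL_2(O_L)` consists of the matrices with entries of nonnegative valuation and
determinant of valuation `0`.  The Hodge point `μ(b)` of `b ∈ GL_2(L)` is the
unique pair `μ₁ ≥ μ₂` with `b = c₁·diag(π^{μ₁}, π^{μ₂})·c₂`,
`c₁, c₂ ∈ GL_2(O_L)`.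

A normal form is `R = diag(π^a, π^b)`, `a ≤ b`, with Newton slopes `{a, b}`,
or `R = [[0, π^h],[1, 0]]`, `h` odd, with Newton slopes `{h/2, h/2}`.
If `b = c·R·σ(c)⁻¹`, `b' = c'·R'·σ(c')⁻¹` with normal forms `R, R'` and
`μ(b) = μ(b')`, `μ(b·σ(b)) = μ(b'·σ(b'))`, then `R` and `R'` have the same
multiset of Newton slopes.
-/

open Matrix

noncomputable section

variable (L : Type) [Field L]

/-- `c ∈ GL_2(O_L)`: entries in the valuation ring, determinant a unit of it. -/
def IsIntUnit (v : L → ℤ) (c : Matrix (Fin 2) (Fin 2) L) : Prop :=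
  (∀ i j, c i j = 0 ∨ 0 ≤ v (c i j)) ∧ c.det ≠ 0 ∧ v c.det = 0

/-- `(μ₁, μ₂)` is the Hodge point of `b ∈ GL_2(L)`. -/
def IsHodgePair (v : L → ℤ) (π : L) (b : Matrix (Fin 2) (Fin 2) L) (μ₁ μ₂ : ℤ) : Prop :=
  μ₂ ≤ μ₁ ∧ ∃ c₁ c₂ : Matrix (Fin 2) (Fin 2) L, IsIntUnit L v c₁ ∧ IsIntUnit L v c₂ ∧
    b = c₁ * Matrix.diagonal ![π ^ μ₁, π ^ μ₂] * c₂

/-- `R` is a normal form with multiset of Newton slopes `slo`. -/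
def IsNormalFormWithSlopes (π : L) (R : Matrix (Fin 2) (Fin 2) L) (slo : Multiset ℚ) : Prop :=
  (∃ a b : ℤ, a ≤ b ∧ R = Matrix.diagonal ![π ^ a, π ^ b] ∧ slo = {(a : ℚ), (b : ℚ)}) ∨
  (∃ h : ℤ, Odd h ∧ R = !![0, π ^ h; 1, 0] ∧ slo = {(h : ℚ) / 2, (h : ℚ) / 2})

/-- The standing data: a discrete valuation, a uniformizer, and a compatible automorphism. -/
structure VD {K : Type} [Field K] (v : K → ℤ) (π : K) (σ : K ≃+* K) : Prop where
  hmul : ∀ x y, x ≠ 0 → y ≠ 0 → v (x * y) = v x + v y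
  hadd : ∀ x y, x ≠ 0 → y ≠ 0 → x + y ≠ 0 → min (v x) (v y) ≤ v (x + y)
  hp0 : π ≠ 0
  hp1 : v π = 1
  hsv : ∀ x, x ≠ 0 → v (σ x) = v x
  hsp : σ π = π

/-- `x` has doubled valuation at least `k`. -/
def PG {K : Type} [Field K] (v : K → ℤ) (k : ℤ) (x : K) : Prop := x = 0 ∨ k ≤ 2 * v x

namespace VD

variable {K : Type} [Field K] {v : K → ℤ} {π : K} {σ : K ≃+* K}

theorem v_one (H : VD v π σ) : v 1 = 0 := by
  have := H.hmul 1 1 one_ne_zero one_ne_zero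
  rw [mul_one] at this; omega

theorem v_neg_one (H : VD v π σ) : v (-1) = 0 := by
  have := H.hmul (-1) (-1) (by simp) (by simp)
  rw [neg_mul_neg, mul_one, H.v_one] at this; omega

theorem v_neg (H : VD v π σ) (x : K) (hx : x ≠ 0) : v (-x) = v x := by
  have := H.hmul (-1) x (by simp) hx
  rw [neg_one_mul, H.v_neg_one] at this; omega

theorem v_inv (H : VD v π σ) (x : K) (hx : x ≠ 0) : v x⁻¹ = - v x := by
  have := H.hmul x x⁻¹ hx (inv_ne_zero hx)
  rw [mul_inv_cancel₀ hx, H.v_one] at this; omega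

theorem v_div (H : VD v π σ) (x y : K) (hx : x ≠ 0) (hy : y ≠ 0) : v (x / y) = v x - v y := by
  rw [div_eq_mul_inv, H.hmul _ _ hx (inv_ne_zero hy), H.v_inv y hy]; ring

theorem v_pow (H : VD v π σ) (n : ℕ) : v (π ^ n) = n := by
  induction n with
  | zero => simp [H.v_one]
  | succ n ih => rw [pow_succ, H.hmul _ _ (pow_ne_zero _ H.hp0) H.hp0, ih, H.hp1]; push_cast; ring

theorem v_zpow (H : VD v π σ) (n : ℤ) : v (π ^ n) = n := by
  obtain ⟨k, rfl | rfl⟩ := n.eq_nat_or_neg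
  · rw [zpow_natCast, H.v_pow]
  · rw [_root_.zpow_neg, zpow_natCast, H.v_inv _ (pow_ne_zero _ H.hp0), H.v_pow]

theorem zp0 (H : VD v π σ) (n : ℤ) : π ^ n ≠ 0 := zpow_ne_zero _ H.hp0

theorem s_zpow (H : VD v π σ) (n : ℤ) : σ (π ^ n) = π ^ n := by
  rw [map_zpow₀, H.hsp]

theorem pmono (_H : VD v π σ) {k l : ℤ} {x : K} (h : PG v k x) (hl : l ≤ k) : PG v l x := by
  rcases h with h | h
  · exact Or.inl h
  · exact Or.inr (hl.trans h)

theorem pmul (H : VD v π σ) {k l : ℤ} {x y : K} (h : PG v k x) (h' : PG v l y) :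
    PG v (k + l) (x * y) := by
  by_cases hx : x = 0
  · left; simp [hx]
  by_cases hy : y = 0
  · left; simp [hy]
  right
  have a := h.resolve_left hx
  have b := h'.resolve_left hy
  rw [H.hmul x y hx hy]; omega

theorem padd (H : VD v π σ) {k : ℤ} {x y : K} (h : PG v k x) (h' : PG v k y) :
    PG v k (x + y) := by
  by_cases hx : x = 0
  · simpa [hx] using h'
  by_cases hy : y = 0
  · simpa [hy] using h
  by_cases hxy : x + y = 0
  · exact Or.inl hxy
  right
  have a := h.resolve_left hx
  have b := h'.resolve_left hy
  have := H.hadd x y hx hy hxy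
  omega

theorem pneg (H : VD v π σ) {k : ℤ} {x : K} (h : PG v k x) : PG v k (-x) := by
  by_cases hx : x = 0
  · left; simp [hx]
  right
  rw [H.v_neg x hx]; exact h.resolve_left hx

theorem psig (H : VD v π σ) {k : ℤ} {x : K} (h : PG v k x) : PG v k (σ x) := by
  by_cases hx : x = 0
  · left; simp [hx]
  right
  rw [H.hsv x hx]; exact h.resolve_left hx

theorem pzp (H : VD v π σ) (n : ℤ) : PG v (2 * n) (π ^ n) := by
  right; rw [H.v_zpow]

theorem pzero (_H : VD v π σ) (n : ℤ) : PG v n 0 := Or.inl rfl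

theorem pzdiv (H : VD v π σ) {k n : ℤ} {x : K} (h : PG v k (π ^ n * x)) : PG v (k - 2 * n) x := by
  have := H.pmul (H.pzp (-n)) h
  rw [← mul_assoc, ← zpow_add₀ H.hp0] at this
  simp only [neg_add_cancel, zpow_zero, one_mul] at this
  exact H.pmono this (by omega)

/-- Matrix version. -/
def _root_.MP {K : Type} [Field K] (v : K → ℤ) (k : ℤ) (M : Matrix (Fin 2) (Fin 2) K) : Prop :=
  ∀ i j, PG v k (M i j)

theorem mmul (H : VD v π σ) {k l : ℤ} {A B : Matrix (Fin 2) (Fin 2) K} (h : MP v k A)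
    (h' : MP v l B) : MP v (k + l) (A * B) := by
  intro i j
  rw [Matrix.mul_apply, Fin.sum_univ_two]
  exact H.padd (H.pmul (h _ _) (h' _ _)) (H.pmul (h _ _) (h' _ _))

theorem msig (H : VD v π σ) {k : ℤ} {A : Matrix (Fin 2) (Fin 2) K} (h : MP v k A) :
    MP v k (A.map σ) := fun i j => by
  rw [Matrix.map_apply]; exact H.psig (h i j)

theorem iu_mp (_H : VD v π σ) {A : Matrix (Fin 2) (Fin 2) K} (h : IsIntUnit K v A) : MP v 0 A := by
  intro i j
  rcases h.1 i j with h | h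
  · exact Or.inl h
  · right; omega

theorem mp_iu (_H : VD v π σ) {A : Matrix (Fin 2) (Fin 2) K} (h : MP v 0 A) (h0 : A.det ≠ 0)
    (h1 : v A.det = 0) : IsIntUnit K v A := by
  refine ⟨fun i j => ?_, h0, h1⟩
  rcases h i j with h | h
  · exact Or.inl h
  · right; omega

theorem iu_mul (H : VD v π σ) {A B : Matrix (Fin 2) (Fin 2) K} (h : IsIntUnit K v A)
    (h' : IsIntUnit K v B) : IsIntUnit K v (A * B) := by
  refine H.mp_iu (by simpa using H.mmul (H.iu_mp h) (H.iu_mp h')) ?_ ?_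
  · rw [Matrix.det_mul]; exact mul_ne_zero h.2.1 h'.2.1
  · rw [Matrix.det_mul, H.hmul _ _ h.2.1 h'.2.1, h.2.2, h'.2.2]; rfl

theorem det_sig (σ : K ≃+* K) (A : Matrix (Fin 2) (Fin 2) K) : (A.map σ).det = σ A.det := by
  simp [Matrix.det_fin_two]

theorem iu_sig (H : VD v π σ) {A : Matrix (Fin 2) (Fin 2) K} (h : IsIntUnit K v A) :
    IsIntUnit K v (A.map σ) := by
  refine H.mp_iu (H.msig (H.iu_mp h)) ?_ ?_
  · rw [det_sig]; simpa using h.2.1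
  · rw [det_sig, H.hsv _ h.2.1, h.2.2]

theorem iu_inv (H : VD v π σ) {A : Matrix (Fin 2) (Fin 2) K} (h : IsIntUnit K v A) :
    MP v 0 A⁻¹ ∧ A * A⁻¹ = 1 ∧ A⁻¹ * A = 1 := by
  have hu : IsUnit A.det := isUnit_iff_ne_zero.2 h.2.1
  refine ⟨?_, Matrix.mul_nonsing_inv A hu, Matrix.nonsing_inv_mul A hu⟩
  have hA := H.iu_mp h
  have hd : PG v 0 (A.det)⁻¹ := by
    right; rw [H.v_inv _ h.2.1, h.2.2]; simp
  rw [Matrix.inv_def, Ring.inverse_eq_inv', Matrix.adjugate_fin_two]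
  intro i j
  rw [Matrix.smul_apply, smul_eq_mul]
  refine H.pmono (H.pmul hd (l := 0) ?_) (by simp)
  fin_cases i <;> fin_cases j <;> simp
  · exact hA 1 1
  · exact H.pneg (hA 0 1)
  · exact H.pneg (hA 1 0)
  · exact hA 0 0

/-! Existence of the Hodge pair. -/

theorem smith_aux (H : VD v π σ) (A : Matrix (Fin 2) (Fin 2) K) (h0 : A.det ≠ 0)
    (hw : A 1 1 ≠ 0) (hm : MP v (2 * v (A 1 1)) A) : ∃ m1 m2, IsHodgePair K v π A m1 m2 := by
  set w := A 1 1 with hwd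
  have hα : A.det / w ≠ 0 := div_ne_zero h0 hw
  have hq : ∀ i j, PG v 0 (A i j / w) := by
    intro i j
    by_cases h : A i j = 0
    · left; simp [h]
    right
    rw [H.v_div _ _ h hw]
    have := (hm i j).resolve_left h
    omega
  have hdet : A.det = A 0 0 * w - A 0 1 * A 1 0 := Matrix.det_fin_two A
  have hge : v w ≤ v (A.det / w) := by
    have : PG v (2 * v w) (A.det / w) := by
      have e : A.det / w = A 0 0 + -(A 0 1 * (A 1 0 / w)) := by
        rw [hdet]; field_simp; ring
      rw [e]
      exact H.padd (hm 0 0) (H.pneg (by simpa using H.pmul (hm 0 1) (hq 1 0)))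
    have := this.resolve_left hα
    omega
  set α := A.det / w with hαd
  set m1 := v α
  set m2 := v w
  have e1 : v (α / π ^ m1) = 0 := by rw [H.v_div _ _ hα (H.zp0 _), H.v_zpow]; simp [m1]
  have e2 : v (w / π ^ m2) = 0 := by rw [H.v_div _ _ hw (H.zp0 _), H.v_zpow]; simp [m2]
  have n1 : α / π ^ m1 ≠ 0 := div_ne_zero hα (H.zp0 _)
  have n2 : w / π ^ m2 ≠ 0 := div_ne_zero hw (H.zp0 _)
  have p1 : PG v 0 (1 : K) := by right; rw [H.v_one]; simp
  refine ⟨m1, m2, hge, !![1, A 0 1 / w; 0, 1],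
    !![α / π ^ m1, 0; (w / π ^ m2) * (A 1 0 / w), w / π ^ m2], ?_, ?_, ?_⟩
  · refine H.mp_iu ?_ (by simp [Matrix.det_fin_two]) (by simp [Matrix.det_fin_two, H.v_one])
    intro i j
    fin_cases i <;> fin_cases j <;> simp
    · exact p1
    · exact hq 0 1
    · exact H.pzero _
    · exact p1
  · refine H.mp_iu ?_ ?_ ?_
    · intro i j
      fin_cases i <;> fin_cases j
      · exact Or.inr (by simp only [e1]; simpa using e1.ge)
      · exact H.pzero _
      · have : PG v 0 (w / π ^ m2) := Or.inr (by rw [e2]; simp)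
        exact H.pmul this (hq 1 0)
      · exact Or.inr (by simpa using e2.ge)
    · simpa only [Matrix.det_fin_two_of, zero_mul, sub_zero] using mul_ne_zero n1 n2
    · rw [Matrix.det_fin_two_of, zero_mul, sub_zero, H.hmul _ _ n1 n2, e1, e2]; rfl
  · have z1 := H.zp0 m1
    have z2 := H.zp0 m2
    have ha : A 0 0 = α + A 0 1 * A 1 0 / w := by
      rw [hαd, hdet]; field_simp; ring
    ext i j
    fin_cases i <;> fin_cases j <;>
      rw [Matrix.mul_apply, Fin.sum_univ_two, Matrix.mul_diagonal, Matrix.mul_diagonal] <;> simp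
    · rw [ha]; field_simp
    · field_simp
    · field_simp
    · rw [← hwd]; field_simp

theorem iu_swap (H : VD v π σ) : IsIntUnit K v !![0, 1; 1, 0] := by
  refine H.mp_iu ?_ (by simp [Matrix.det_fin_two]) (by simp [Matrix.det_fin_two, H.v_neg_one])
  have p1 : PG v 0 (1 : K) := by right; rw [H.v_one]; simp
  intro i j
  fin_cases i <;> fin_cases j <;> simp
  · exact H.pzero _
  · exact p1
  · exact p1
  · exact H.pzero _

theorem swap_sq : (!![0, 1; 1, 0] : Matrix (Fin 2) (Fin 2) K) * !![0, 1; 1, 0] = 1 := by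
  ext i j
  fin_cases i <;> fin_cases j <;> simp

theorem hodge_left (H : VD v π σ) {A : Matrix (Fin 2) (Fin 2) K}
    (h : ∃ m1 m2, IsHodgePair K v π (!![0, 1; 1, 0] * A) m1 m2) :
    ∃ m1 m2, IsHodgePair K v π A m1 m2 := by
  obtain ⟨m1, m2, h, c1, c2, h1, h2, e⟩ := h
  refine ⟨m1, m2, h, !![0, 1; 1, 0] * c1, c2, H.iu_mul H.iu_swap h1, h2, ?_⟩
  calc A = (!![0, 1; 1, 0] * !![0, 1; 1, 0]) * A := by rw [swap_sq, one_mul]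
    _ = _ := by rw [mul_assoc, e]; simp only [mul_assoc]

theorem hodge_right (H : VD v π σ) {A : Matrix (Fin 2) (Fin 2) K}
    (h : ∃ m1 m2, IsHodgePair K v π (A * !![0, 1; 1, 0]) m1 m2) :
    ∃ m1 m2, IsHodgePair K v π A m1 m2 := by
  obtain ⟨m1, m2, h, c1, c2, h1, h2, e⟩ := h
  refine ⟨m1, m2, h, c1, c2 * !![0, 1; 1, 0], h1, H.iu_mul h2 H.iu_swap, ?_⟩
  calc A = A * (!![0, 1; 1, 0] * !![0, 1; 1, 0]) := by rw [swap_sq, mul_one]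
    _ = _ := by rw [← mul_assoc, e]; simp only [mul_assoc]

theorem exists_min (_H : VD v π σ) (A : Matrix (Fin 2) (Fin 2) K) (h0 : A ≠ 0) :
    ∃ i j, A i j ≠ 0 ∧ MP v (2 * v (A i j)) A := by
  classical
  have hne : ((Finset.univ : Finset (Fin 2 × Fin 2)).filter (fun q => A q.1 q.2 ≠ 0)).Nonempty := by
    by_contra hcon
    apply h0
    ext i j
    by_contra hij
    exact hcon ⟨(i, j), by simpa using hij⟩
  obtain ⟨q, hq, hmin⟩ := Finset.exists_min_image _ (fun q => v (A q.1 q.2)) hne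
  refine ⟨q.1, q.2, by simpa using hq, fun i j => ?_⟩
  by_cases h : A i j = 0
  · exact Or.inl h
  · right
    have := hmin (i, j) (by simpa using h)
    simp only at this
    omega

theorem smith (H : VD v π σ) (A : Matrix (Fin 2) (Fin 2) K) (h0 : A.det ≠ 0) :
    ∃ m1 m2, IsHodgePair K v π A m1 m2 := by
  have hA : A ≠ 0 := by rintro rfl; simp at h0
  obtain ⟨i, j, hij, hm⟩ := H.exists_min A hA
  have dl : ∀ B : Matrix (Fin 2) (Fin 2) K, B.det ≠ 0 → (!![0, 1; 1, 0] * B).det ≠ 0 := by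
    intro B hB; rw [Matrix.det_mul]; exact mul_ne_zero (by simp) hB
  have dr : ∀ B : Matrix (Fin 2) (Fin 2) K, B.det ≠ 0 → (B * !![0, 1; 1, 0]).det ≠ 0 := by
    intro B hB; rw [Matrix.det_mul]; exact mul_ne_zero hB (by simp)
  have ml : ∀ (k : ℤ) (B : Matrix (Fin 2) (Fin 2) K), MP v k B → MP v k (!![0, 1; 1, 0] * B) := by
    intro k B hB; simpa using H.mmul (H.iu_mp H.iu_swap) hB
  have mr : ∀ (k : ℤ) (B : Matrix (Fin 2) (Fin 2) K), MP v k B → MP v k (B * !![0, 1; 1, 0]) := by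
    intro k B hB; simpa using H.mmul hB (H.iu_mp H.iu_swap)
  have el : ∀ (B : Matrix (Fin 2) (Fin 2) K) (j : Fin 2),
      ((!![0, 1; 1, 0] : Matrix (Fin 2) (Fin 2) K) * B) 1 j = B 0 j := by
    intro B j; simp [Matrix.mul_apply, Fin.sum_univ_two]
  have er : ∀ (B : Matrix (Fin 2) (Fin 2) K) (j : Fin 2),
      (B * (!![0, 1; 1, 0] : Matrix (Fin 2) (Fin 2) K)) j 1 = B j 0 := by
    intro B j; simp [Matrix.mul_apply, Fin.sum_univ_two]
  fin_cases i <;> fin_cases j <;> simp only [Fin.zero_eta, Fin.mk_one] at hij hm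
  · apply H.hodge_left
    apply H.hodge_right
    apply H.smith_aux _ (dr _ (dl _ h0))
    · rw [er, el]; exact hij
    · rw [er, el]; exact mr _ _ (ml _ _ hm)
  · apply H.hodge_left
    apply H.smith_aux _ (dl _ h0)
    · rw [el]; exact hij
    · rw [el]; exact ml _ _ hm
  · apply H.hodge_right
    apply H.smith_aux _ (dr _ h0)
    · rw [er]; exact hij
    · rw [er]; exact mr _ _ hm
  · exact H.smith_aux _ h0 hij hm

/-! The core computation. -/

theorem step (H : VD v π σ) {m1 m2 e w k : ℤ} {g : Matrix (Fin 2) (Fin 2) K} (hg : MP v 0 g)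
    (hs : PG v (2 * e) (g 1 1)) (hw0 : 0 ≤ w) (hw1 : w ≤ 2 * e) (hw2 : w ≤ m1 - m2) {x y : K}
    (hx : PG v k x) (hy : PG v (k - w) y) :
    PG v (k + (2 * m2 + w)) (π ^ m1 * (g 0 0 * σ x + g 0 1 * σ y)) ∧
    PG v (k + (2 * m2 + w) - w) (π ^ m2 * (g 1 0 * σ x + g 1 1 * σ y)) := by
  have hx' := H.psig hx
  have hy' := H.psig hy
  constructor
  · refine H.pmono (H.pmul (H.pzp m1) (l := k - w) (H.padd ?_ ?_)) (by omega)
    · exact H.pmono (H.pmul (hg 0 0) hx') (by omega)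
    · exact H.pmono (H.pmul (hg 0 1) hy') (by omega)
  · refine H.pmono (H.pmul (H.pzp m2) (l := k) (H.padd ?_ ?_)) (by omega)
    · exact H.pmono (H.pmul (hg 1 0) hx') (by omega)
    · exact H.pmono (H.pmul hs hy') (by omega)

theorem lower (H : VD v π σ) {m1 m2 e w h : ℤ} {g : Matrix (Fin 2) (Fin 2) K} (hg : MP v 0 g)
    (hs : PG v (2 * e) (g 1 1)) (hw0 : 0 ≤ w) (hw1 : w ≤ 2 * e) (hw2 : w ≤ m1 - m2) {x y X Y : K}
    (hxy : x ≠ 0 ∨ y ≠ 0)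
    (hX : X = π ^ m1 * (g 0 0 * σ x + g 0 1 * σ y))
    (hY : Y = π ^ m2 * (g 1 0 * σ x + g 1 1 * σ y))
    (h1 : π ^ h * x = π ^ m1 * (g 0 0 * σ X + g 0 1 * σ Y))
    (h2 : π ^ h * y = π ^ m2 * (g 1 0 * σ X + g 1 1 * σ Y)) : 2 * m2 + w ≤ h := by
  have key : ∀ k, PG v k x → PG v (k - w) y →
      PG v (k + 2 * (2 * m2 + w) - 2 * h) x ∧ PG v (k + 2 * (2 * m2 + w) - w - 2 * h) y := by
    intro k hx hy
    obtain ⟨a, b⟩ := H.step hg hs hw0 hw1 hw2 hx hy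
    rw [← hX] at a
    rw [← hY] at b
    obtain ⟨a', b'⟩ := H.step hg hs hw0 hw1 hw2 a b
    rw [← h1] at a'
    rw [← h2] at b'
    exact ⟨H.pmono (H.pzdiv a') (by omega), H.pmono (H.pzdiv b') (by omega)⟩
  by_cases hx : x = 0
  · have hy := hxy.resolve_left (not_not.2 hx)
    have := (key (2 * v y + w) (Or.inl hx) (Or.inr (by omega))).2.resolve_left hy
    omega
  by_cases hy : y = 0
  · have := (key (2 * v x) (Or.inr le_rfl) (Or.inl hy)).1.resolve_left hx
    omega
  have := key (min (2 * v x) (2 * v y + w)) (Or.inr (by omega)) (Or.inr (by omega))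
  have t1 := this.1.resolve_left hx
  have t2 := this.2.resolve_left hy
  omega

/-- One step of the semilinear map attached to `A`. -/
def psi (A : Matrix (Fin 2) (Fin 2) K) (σ : K ≃+* K) (M : Matrix (Fin 2) (Fin 2) K) :
    Matrix (Fin 2) (Fin 2) K := A * M.map σ

theorem cone (H : VD v π σ) {m1 m2 e : ℤ} {g : Matrix (Fin 2) (Fin 2) K} (hg : MP v 0 g)
    (hs0 : g 1 1 ≠ 0) (hs : v (g 1 1) = e) (he : 0 ≤ e) (hlt : 2 * e < m1 - m2) {x y : K}
    (hy : y ≠ 0) (hx : PG v (2 * v y + 2 * e + 1) x) :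
    π ^ m2 * (g 1 0 * σ x + g 1 1 * σ y) ≠ 0 ∧
    v (π ^ m2 * (g 1 0 * σ x + g 1 1 * σ y)) = v y + (m2 + e) ∧
    PG v (2 * (v y + (m2 + e)) + 2 * e + 1) (π ^ m1 * (g 0 0 * σ x + g 0 1 * σ y)) := by
  have hx' := H.psig hx
  have hsy0 : σ y ≠ 0 := by simpa using hy
  have hsy := H.hsv y hy
  have p1 : PG v (2 * (v y + e) + 1) (g 1 0 * σ x) := H.pmono (H.pmul (hg 1 0) hx') (by omega)
  have n2 : g 1 1 * σ y ≠ 0 := mul_ne_zero hs0 hsy0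
  have v2 : v (g 1 1 * σ y) = v y + e := by rw [H.hmul _ _ hs0 hsy0, hs, hsy]; ring
  have p2 : PG v (2 * (v y + e)) (g 1 1 * σ y) := Or.inr (by omega)
  have hnot : ¬ PG v (2 * (v y + e) + 1) (g 1 0 * σ x + g 1 1 * σ y) := by
    intro hc
    have := H.padd hc (H.pneg p1)
    rw [add_neg_eq_iff_eq_add.2 (add_comm _ _)] at this
    have := this.resolve_left n2
    omega
  have p3 : PG v (2 * (v y + e)) (g 1 0 * σ x + g 1 1 * σ y) := H.padd (H.pmono p1 (by omega)) p2
  have n3 : g 1 0 * σ x + g 1 1 * σ y ≠ 0 := fun hc => hnot (Or.inl hc)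
  have v3 : v (g 1 0 * σ x + g 1 1 * σ y) = v y + e := by
    have a := p3.resolve_left n3
    have b : ¬ (2 * (v y + e) + 1 ≤ 2 * v (g 1 0 * σ x + g 1 1 * σ y)) := fun hc => hnot (Or.inr hc)
    omega
  refine ⟨mul_ne_zero (H.zp0 _) n3, ?_, ?_⟩
  · rw [H.hmul _ _ (H.zp0 _) n3, H.v_zpow, v3]; ring
  · refine H.pmono (H.pmul (H.pzp m1) (l := 2 * v y) (H.padd ?_ ?_)) (by omega)
    · exact H.pmono (H.pmul (hg 0 0) hx') (by omega)
    · have : PG v (2 * v y) (σ y) := Or.inr (by omega)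
      exact H.pmono (H.pmul (hg 0 1) this) (by omega)

theorem dg_apply (m1 m2 : ℤ) (g M : Matrix (Fin 2) (Fin 2) K) (j : Fin 2) :
    psi (Matrix.diagonal ![π ^ m1, π ^ m2] * g) σ M 0 j
      = π ^ m1 * (g 0 0 * σ (M 0 j) + g 0 1 * σ (M 1 j)) ∧
    psi (Matrix.diagonal ![π ^ m1, π ^ m2] * g) σ M 1 j
      = π ^ m2 * (g 1 0 * σ (M 0 j) + g 1 1 * σ (M 1 j)) := by
  simp only [psi, mul_assoc]
  constructor <;> simp [Matrix.diagonal_mul, Matrix.mul_apply, Fin.sum_univ_two]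

theorem exists_bound (H : VD v π σ) (A : Matrix (Fin 2) (Fin 2) K) : ∃ k, MP v k A := by
  by_cases h : A = 0
  · exact ⟨0, fun i j => Or.inl (by simp [h])⟩
  · obtain ⟨i, j, _, h⟩ := H.exists_min A h
    exact ⟨_, h⟩

theorem map_mul' (σ : K ≃+* K) (A B : Matrix (Fin 2) (Fin 2) K) :
    (A * B).map σ = A.map σ * B.map σ := Matrix.map_mul

theorem upper (H : VD v π σ) {m1 m2 e h1 h2 : ℤ} {g A c : Matrix (Fin 2) (Fin 2) K}
    (hg : MP v 0 g) (hs0 : g 1 1 ≠ 0) (hs : v (g 1 1) = e) (he : 0 ≤ e)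
    (hlt : 2 * e < m1 - m2) (hA : A = Matrix.diagonal ![π ^ m1, π ^ m2] * g) (h12 : h1 ≤ h2)
    (hc : IsUnit c.det)
    (hE : A * A.map σ * (c.map σ).map σ = c * Matrix.diagonal ![π ^ h1, π ^ h2]) :
    h1 ≤ 2 * (m2 + e) := by
  -- iterate on the identity matrix, second column
  have it : ∀ k : ℕ, ((psi A σ)^[k] 1) 1 1 ≠ 0 ∧ v (((psi A σ)^[k] 1) 1 1) = k * (m2 + e) ∧
      PG v (2 * (k * (m2 + e)) + 2 * e + 1) (((psi A σ)^[k] 1) 0 1) := by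
    intro k
    induction k with
    | zero => simp [H.v_one, PG]
    | succ k ih =>
      obtain ⟨i1, i2, i3⟩ := ih
      rw [Function.iterate_succ_apply']
      set M := (psi A σ)^[k] 1
      have := dg_apply (π := π) (σ := σ) m1 m2 g M 1
      rw [← hA] at this
      rw [this.1, this.2]
      rw [← i2] at i3
      obtain ⟨a, b, d⟩ := H.cone hg hs0 hs he hlt i1 i3
      have e' : v (M 1 1) + (m2 + e) = ((k + 1 : ℕ) : ℤ) * (m2 + e) := by
        rw [i2]; push_cast; ring
      rw [e'] at b d
      exact ⟨a, b, d⟩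
  have hD : MP v (2 * h1) (Matrix.diagonal ![π ^ h1, π ^ h2]) := by
    intro i j
    fin_cases i <;> fin_cases j <;> simp
    · exact H.pzp _
    · exact H.pzero _
    · exact H.pzero _
    · exact H.pmono (H.pzp _) (by omega)
  obtain ⟨k1, hk1⟩ := H.exists_bound c
  obtain ⟨k2, hk2⟩ := H.exists_bound c⁻¹
  have it2 : ∀ k : ℕ, ∃ N, MP v (k2 + k * (2 * h1)) N ∧ (psi A σ)^[2 * k] 1 = c * N := by
    intro k
    induction k with
    | zero => exact ⟨c⁻¹, by simpa using hk2, by simp [Matrix.mul_nonsing_inv _ hc]⟩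
    | succ k ih =>
      obtain ⟨N, hN, eN⟩ := ih
      refine ⟨Matrix.diagonal ![π ^ h1, π ^ h2] * (N.map σ).map σ, ?_, ?_⟩
      · have := H.mmul hD (H.msig (H.msig hN))
        intro i j
        exact H.pmono (this i j) (by push_cast; linarith)
      · rw [show 2 * (k + 1) = 2 * k + 1 + 1 by ring, Function.iterate_succ_apply',
          Function.iterate_succ_apply', eN]
        simp only [psi, map_mul']
        rw [← mul_assoc c, ← hE]
        simp only [mul_assoc]
  by_contra hcon
  push Not at hcon
  set n : ℕ := (1 - (k1 + k2)).toNat with hn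
  obtain ⟨N, hN, eN⟩ := it2 n
  obtain ⟨i1, i2, -⟩ := it (2 * n)
  have hh := H.mmul hk1 hN 1 1
  rw [← eN] at hh
  have hh := hh.resolve_left i1
  rw [i2] at hh
  have hn' : 1 - (k1 + k2) ≤ (n : ℤ) := Int.self_le_toNat _
  have hn0 : (0 : ℤ) ≤ n := by positivity
  push_cast at hh
  nlinarith

theorem core (H : VD v π σ) {m1 m2 n2 h1 h2 : ℤ} {g A c : Matrix (Fin 2) (Fin 2) K}
    (hg : IsIntUnit K v g) (hm : m2 ≤ m1)
    (hA : A = Matrix.diagonal ![π ^ m1, π ^ m2] * g) (h12 : h1 ≤ h2) (hc : IsUnit c.det)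
    (hn : MP v (2 * n2) (A * Matrix.diagonal ![π ^ m1, π ^ m2]))
    (hn' : ¬ MP v (2 * n2 + 1) (A * Matrix.diagonal ![π ^ m1, π ^ m2]))
    (hE : A * A.map σ * (c.map σ).map σ = c * Matrix.diagonal ![π ^ h1, π ^ h2]) :
    h1 = min (2 * (n2 - m2)) (m1 + m2) ∧ h1 + h2 = 2 * (m1 + m2) := by
  have hg0 := H.iu_mp hg
  have hsum : h1 + h2 = 2 * (m1 + m2) := by
    have hd := congrArg Matrix.det hE
    have hA' : A.det = π ^ m1 * π ^ m2 * g.det := by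
      rw [hA, Matrix.det_mul, Matrix.det_diagonal]; simp
    have nA : A.det ≠ 0 := by
      rw [hA']; exact mul_ne_zero (mul_ne_zero (H.zp0 _) (H.zp0 _)) hg.2.1
    have vA : v A.det = m1 + m2 := by
      rw [hA', H.hmul _ _ (mul_ne_zero (H.zp0 _) (H.zp0 _)) hg.2.1, H.hmul _ _ (H.zp0 _) (H.zp0 _),
        H.v_zpow, H.v_zpow, hg.2.2, add_zero]
    have nc : c.det ≠ 0 := hc.ne_zero
    have ns : ∀ x, x ≠ 0 → σ x ≠ 0 := fun x hx => by simpa using hx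
    rw [Matrix.det_mul, Matrix.det_mul, Matrix.det_mul, det_sig, det_sig, det_sig,
      Matrix.det_diagonal] at hd
    simp only [Fin.prod_univ_two, Matrix.cons_val_zero, Matrix.cons_val_one] at hd
    have hd := congrArg v hd
    rw [H.hmul _ _ (mul_ne_zero nA (ns _ nA)) (ns _ (ns _ nc)), H.hmul _ _ nA (ns _ nA),
      H.hmul _ _ nc (mul_ne_zero (H.zp0 _) (H.zp0 _)), H.hmul _ _ (H.zp0 _) (H.zp0 _),
      H.hsv _ (ns _ nc), H.hsv _ nc, H.hsv _ nA, vA, H.v_zpow, H.v_zpow] at hd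
    omega
  refine ⟨?_, hsum⟩
  have ent : ∀ i j, (A * Matrix.diagonal ![π ^ m1, π ^ m2]) i j
      = (![π ^ m1, π ^ m2] i * ![π ^ m1, π ^ m2] j) * g i j := by
    intro i j
    rw [hA, Matrix.mul_diagonal, Matrix.diagonal_mul]; ring
  have hs : PG v (2 * (n2 - 2 * m2)) (g 1 1) := by
    have := hn 1 1
    rw [ent] at this
    simp only [Matrix.cons_val_one, mul_assoc] at this
    exact H.pmono (H.pzdiv (H.pzdiv this)) (by omega)
  have p00 : PG v (2 * m1 + 2 * m1) ((A * Matrix.diagonal ![π ^ m1, π ^ m2]) 0 0) := by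
    rw [ent]; exact H.pmono (H.pmul (H.pmul (H.pzp m1) (H.pzp m1)) (hg0 0 0)) (by omega)
  have p01 : PG v (2 * m1 + 2 * m2) ((A * Matrix.diagonal ![π ^ m1, π ^ m2]) 0 1) := by
    rw [ent]; exact H.pmono (H.pmul (H.pmul (H.pzp m1) (H.pzp m2)) (hg0 0 1)) (by omega)
  have p10 : PG v (2 * m1 + 2 * m2) ((A * Matrix.diagonal ![π ^ m1, π ^ m2]) 1 0) := by
    rw [ent]; exact H.pmono (H.pmul (H.pmul (H.pzp m2) (H.pzp m1)) (hg0 1 0)) (by omega)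
  have p11 : ∀ k, PG v k (g 1 1) →
      PG v (2 * m2 + 2 * m2 + k) ((A * Matrix.diagonal ![π ^ m1, π ^ m2]) 1 1) := by
    intro k hk
    rw [ent]; exact H.pmul (H.pmul (H.pzp m2) (H.pzp m2)) hk
  have he : 2 * m2 ≤ n2 := by
    by_contra hcon
    apply hn'
    intro i j
    fin_cases i <;> fin_cases j
    · exact H.pmono p00 (by omega)
    · exact H.pmono p01 (by omega)
    · exact H.pmono p10 (by omega)
    · exact H.pmono (p11 0 (hg0 1 1)) (by omega)
  have lo : 2 * m2 + min (2 * (n2 - 2 * m2)) (m1 - m2) ≤ h1 := by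
    have hcol : c 0 0 ≠ 0 ∨ c 1 0 ≠ 0 := by
      by_contra hcon
      push Not at hcon
      apply hc.ne_zero
      rw [Matrix.det_fin_two, hcon.1, hcon.2]; ring
    have hE' : psi A σ (psi A σ c) = c * Matrix.diagonal ![π ^ h1, π ^ h2] := by
      rw [← hE]; simp only [psi, map_mul', mul_assoc]
    have a1 := dg_apply (π := π) (σ := σ) m1 m2 g c 0
    have a2 := dg_apply (π := π) (σ := σ) m1 m2 g (psi A σ c) 0
    rw [← hA] at a1 a2
    rw [hE'] at a2
    simp only [Matrix.mul_diagonal, Matrix.cons_val_zero] at a2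
    exact H.lower hg0 hs (by omega) (by omega) (by omega) hcol a1.1 a1.2
      (by rw [mul_comm]; exact a2.1) (by rw [mul_comm]; exact a2.2)
  by_cases hlt : 2 * (n2 - 2 * m2) < m1 - m2
  · have hns : ¬ PG v (2 * (n2 - 2 * m2) + 1) (g 1 1) := by
      intro hcon
      apply hn'
      intro i j
      fin_cases i <;> fin_cases j
      · exact H.pmono p00 (by omega)
      · exact H.pmono p01 (by omega)
      · exact H.pmono p10 (by omega)
      · exact H.pmono (p11 _ hcon) (by omega)
    have hs0 : g 1 1 ≠ 0 := fun hcon => hns (Or.inl hcon)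
    have hvs : v (g 1 1) = n2 - 2 * m2 := by
      have a := hs.resolve_left hs0
      have b : ¬ (2 * (n2 - 2 * m2) + 1 ≤ 2 * v (g 1 1)) := fun hcon => hns (Or.inr hcon)
      omega
    have := H.upper hg0 hs0 hvs (by omega) hlt hA h12 hc hE
    omega
  · omega

theorem main (H : VD v π σ) {m1 m2 n1 n2 h1 h2 : ℤ} {b c : Matrix (Fin 2) (Fin 2) K}
    (hb : IsHodgePair K v π b m1 m2) (hbb : IsHodgePair K v π (b * b.map σ) n1 n2)
    (h12 : h1 ≤ h2) (hc : IsUnit c.det)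
    (hE : b * b.map σ * (c.map σ).map σ = c * Matrix.diagonal ![π ^ h1, π ^ h2]) :
    h1 = min (2 * (n2 - m2)) (m1 + m2) ∧ h1 + h2 = 2 * (m1 + m2) := by
  obtain ⟨hm, c1, c2, hc1, hc2, eb⟩ := hb
  obtain ⟨hn, c3, c4, hc3, hc4, ebb⟩ := hbb
  set D : Matrix (Fin 2) (Fin 2) K := Matrix.diagonal ![π ^ m1, π ^ m2] with hD
  set E : Matrix (Fin 2) (Fin 2) K := Matrix.diagonal ![π ^ n1, π ^ n2] with hEd
  obtain ⟨i1, r1, l1⟩ := H.iu_inv hc1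
  obtain ⟨i3, r3, l3⟩ := H.iu_inv hc3
  obtain ⟨i4, r4, l4⟩ := H.iu_inv hc4
  obtain ⟨i2, r2, l2⟩ := H.iu_inv (H.iu_sig hc2)
  have hDs : D.map σ = D := by
    ext i j
    fin_cases i <;> fin_cases j <;> simp [hD, H.hsp]
  have e1 : c1 * (D * (c2 * c1.map σ) * D) * c2.map σ = c3 * E * c4 := by
    rw [← ebb, eb]; simp only [map_mul', hDs, mul_assoc]
  have e2 : D * (c2 * c1.map σ) * D = c1⁻¹ * c3 * E * (c4 * (c2.map σ)⁻¹) := by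
    calc D * (c2 * c1.map σ) * D
        = (c1⁻¹ * c1) * (D * (c2 * c1.map σ) * D) * (c2.map σ * (c2.map σ)⁻¹) := by
          rw [l1, r2, one_mul, mul_one]
      _ = c1⁻¹ * (c1 * (D * (c2 * c1.map σ) * D) * c2.map σ) * (c2.map σ)⁻¹ := by
          simp only [mul_assoc]
      _ = _ := by rw [e1]; simp only [mul_assoc]
  have e3 : E = c3⁻¹ * c1 * (D * (c2 * c1.map σ) * D) * (c2.map σ * c4⁻¹) := by
    calc E = (c3⁻¹ * c3) * E * (c4 * c4⁻¹) := by rw [l3, r4, one_mul, mul_one]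
      _ = c3⁻¹ * (c3 * E * c4) * c4⁻¹ := by simp only [mul_assoc]
      _ = _ := by rw [← e1]; simp only [mul_assoc]
  have z : ∀ {k : ℤ} {U M V : Matrix (Fin 2) (Fin 2) K}, MP v 0 U → MP v k M → MP v 0 V →
      MP v k (U * M * V) := by
    intro k U M V hU hM hV
    simpa using H.mmul (H.mmul hU hM) hV
  have zz : ∀ {U V : Matrix (Fin 2) (Fin 2) K}, MP v 0 U → MP v 0 V → MP v 0 (U * V) := by
    intro U V hU hV
    simpa using H.mmul hU hV
  have hc1u : IsUnit c1⁻¹.det := by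
    rw [Matrix.det_nonsing_inv]
    simpa using hc1.2.1
  refine H.core (g := c2 * c1.map σ) (A := D * (c2 * c1.map σ)) (c := c1⁻¹ * c)
    (H.iu_mul hc2 (H.iu_sig hc1)) hm rfl h12 ?_ ?_ ?_ ?_
  · rw [Matrix.det_mul]; exact hc1u.mul hc
  · rw [← hD, e2]
    refine z (zz i1 (H.iu_mp hc3)) ?_ (zz (H.iu_mp hc4) i2)
    intro i j
    fin_cases i <;> fin_cases j <;> simp [hEd]
    · exact H.pmono (H.pzp _) (by omega)
    · exact H.pzero _
    · exact H.pzero _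
    · exact H.pzp _
  · intro hcon
    have hE1 : MP v (2 * n2 + 1) E := by
      rw [e3]
      exact z (zz i3 (H.iu_mp hc1)) hcon (zz (H.msig (H.iu_mp hc2)) i4)
    have := hE1 1 1
    simp only [hEd, Matrix.diagonal_apply_eq, Matrix.cons_val_one, Matrix.cons_val_zero,
      Matrix.cons_val_fin_one] at this
    have := this.resolve_left (H.zp0 _)
    rw [H.v_zpow] at this
    omega
  · have hs1 : c1.map σ * (c1⁻¹).map σ = 1 := by
      rw [← map_mul', r1]; simp
    have e4 : c1 * (D * (c2 * c1.map σ)) = b * c1.map σ := by rw [eb]; simp only [mul_assoc]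
    have e5 : D * (c2 * c1.map σ) = c1⁻¹ * b * c1.map σ := by
      rw [mul_assoc c1⁻¹, ← e4, ← mul_assoc c1⁻¹, l1, one_mul]
    have hs2 : (c1.map σ).map σ * ((c1⁻¹).map σ).map σ = 1 := by
      rw [← map_mul', hs1]; simp
    rw [e5]
    simp only [map_mul']
    calc c1⁻¹ * b * c1.map σ * ((c1⁻¹).map σ * b.map σ * (c1.map σ).map σ)
          * (((c1⁻¹).map σ).map σ * (c.map σ).map σ)
        = c1⁻¹ * b * (c1.map σ * (c1⁻¹).map σ) * b.map σ *
          ((c1.map σ).map σ * ((c1⁻¹).map σ).map σ) * (c.map σ).map σ := by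
          simp only [mul_assoc]
      _ = c1⁻¹ * (b * b.map σ * (c.map σ).map σ) := by
          rw [hs1, hs2]; simp only [mul_assoc, mul_one, one_mul]
      _ = _ := by rw [hE]; simp only [mul_assoc]

theorem nf (H : VD v π σ) {R : Matrix (Fin 2) (Fin 2) K} {slo : Multiset ℚ}
    (hR : IsNormalFormWithSlopes K π R slo) :
    ∃ h1 h2 : ℤ, h1 ≤ h2 ∧ R * R.map σ = Matrix.diagonal ![π ^ h1, π ^ h2] ∧
      slo = {(h1 : ℚ) / 2, (h2 : ℚ) / 2} ∧ R.det ≠ 0 := by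
  rcases hR with ⟨a, b, hab, rfl, rfl⟩ | ⟨h, _, rfl, rfl⟩
  · refine ⟨2 * a, 2 * b, by omega, ?_, ?_, ?_⟩
    · rw [two_mul, two_mul, zpow_add₀ H.hp0, zpow_add₀ H.hp0]
      ext i j
      fin_cases i <;> fin_cases j <;> simp [H.hsp]
    · push_cast
      rw [mul_div_cancel_left₀ _ two_ne_zero, mul_div_cancel_left₀ _ two_ne_zero]
    · rw [Matrix.det_diagonal]; simp [H.zp0]
  · refine ⟨h, h, le_rfl, ?_, rfl, ?_⟩
    · ext i j
      fin_cases i <;> fin_cases j <;> simp [Matrix.mul_apply, Fin.sum_univ_two, H.hsp]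
    · simp [Matrix.det_fin_two, H.zp0]

theorem prep (_H : VD v π σ) {R b c D : Matrix (Fin 2) (Fin 2) K} (hc : IsUnit c.det)
    (hRd : R.det ≠ 0) (hR : R * R.map σ = D) (hb : b = c * R * (c.map σ)⁻¹) :
    b * b.map σ * (c.map σ).map σ = c * D ∧ b.det ≠ 0 := by
  have hu : IsUnit (c.map σ).det := by
    rw [det_sig]; exact hc.map σ
  have h1 : b * c.map σ = c * R := by
    rw [hb, mul_assoc, Matrix.nonsing_inv_mul _ hu, mul_one]
  constructor
  · rw [mul_assoc, ← map_mul', h1, map_mul', ← mul_assoc, h1, mul_assoc, hR]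
  · have := congrArg Matrix.det h1
    rw [Matrix.det_mul, Matrix.det_mul] at this
    intro h0
    rw [h0, zero_mul] at this
    exact mul_ne_zero hc.ne_zero hRd this.symm

end VD

theorem statement_13 (v : L → ℤ) (π : L) (σ : L ≃+* L)
    (hv_mul : ∀ x y, x ≠ 0 → y ≠ 0 → v (x * y) = v x + v y)
    (hv_add : ∀ x y, x ≠ 0 → y ≠ 0 → x + y ≠ 0 → min (v x) (v y) ≤ v (x + y))
    (hπ0 : π ≠ 0) (hπ1 : v π = 1)
    (hσv : ∀ x, x ≠ 0 → v (σ x) = v x) (hσπ : σ π = π)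
    (b b' R R' c c' : Matrix (Fin 2) (Fin 2) L)
    (hc : IsUnit c.det) (hc' : IsUnit c'.det)
    (slo slo' : Multiset ℚ)
    (hR : IsNormalFormWithSlopes L π R slo) (hR' : IsNormalFormWithSlopes L π R' slo')
    (hb : b = c * R * (c.map ⇑σ)⁻¹) (hb' : b' = c' * R' * (c'.map ⇑σ)⁻¹)
    (h1 : ∀ μ₁ μ₂ : ℤ, IsHodgePair L v π b μ₁ μ₂ ↔ IsHodgePair L v π b' μ₁ μ₂)
    (h2 : ∀ μ₁ μ₂ : ℤ, IsHodgePair L v π (b * b.map ⇑σ) μ₁ μ₂ ↔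
      IsHodgePair L v π (b' * b'.map ⇑σ) μ₁ μ₂) :
    slo = slo' := by
  have H : VD v π σ := ⟨hv_mul, hv_add, hπ0, hπ1, hσv, hσπ⟩
  obtain ⟨p1, p2, hp, eR, rfl, dR⟩ := H.nf hR
  obtain ⟨q1, q2, hq, eR', rfl, dR'⟩ := H.nf hR'
  obtain ⟨hE, hd⟩ := H.prep hc dR eR hb
  obtain ⟨hE', hd'⟩ := H.prep hc' dR' eR' hb'
  obtain ⟨m1, m2, hm⟩ := H.smith b hd
  have hdd : (b * b.map σ).det ≠ 0 := by
    rw [Matrix.det_mul, VD.det_sig]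
    exact mul_ne_zero hd (by simpa using hd)
  obtain ⟨n1, n2, hn⟩ := H.smith _ hdd
  obtain ⟨a1, a2⟩ := H.main hm hn hp hc hE
  obtain ⟨b1, b2⟩ := H.main ((h1 _ _).1 hm) ((h2 _ _).1 hn) hq hc' hE'
  have e1 : p1 = q1 := by rw [a1, b1]
  have e2 : p2 = q2 := by omega
  rw [e1, e2]

end
end

section
/- Let n ≥ 2. Define b_1, b_2 ∈ SL_n(ℚ_p) ⊆ SL_n(K) by: b_1·e_j = p⁻¹·e_{j+1} for 1 ≤ j ≤ n−1 and b_1·e_n = (−1)^{n−1}·p^{n−1}·e_1; and b_2·e_j = p⁻¹·e_{j+1} for 1 ≤ j ≤ n−2, b_2·e_{n−1} = (−1)^n·p^{n−1}·e_1, and b_2·e_n = p⁻¹·e_n. Then: (a) for every 1 ≤ i ≤ n−1, μ(b_1^i) = μ(b_2^i) = the decreasing tuple with i entries equal to n−i and n−i entries equal to −i; (b) b_1^n = (−1)^{n−1}·I_n, so μ(b_1^n) = (0,…,0), whereas μ(b_2^n) = (n, 0,…,0, −n); (c) b_2^{n−1} = diag((−1)^n·p, …, (−1)^n·p, p^{1−n})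 (with n−1 entries equal to (−1)^n·p). Since b_1, b_2 have entries in ℚ_p we have (b_jσ)^i = b_j^i·σ^i; in particular the Newton slopes of b_1 are (0,…,0) while those of b_2 are (1/(n−1),…,1/(n−1),−1), so the refined Hodge stratum H_{μ̄,n−1}(SL_n) containing both b_1 and b_2 is not contained in a single Newton stratum. -/
/-!
Statement 15.  The explicit elements `b₁, b₂ ∈ SL_n(ℚ_p) ⊆ SL_n(K)` (here
written 0-indexed: `b₁` sends `e_j ↦ p⁻¹·e_{j+1}` for `j ≤ n−2` and
`e_{n−1} ↦ (−1)^{n−1}·p^{n−1}·e_0`; `b₂` sends `e_j ↦ p⁻¹·e_{j+1}` for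
`j ≤ n−3`, `e_{n−2} ↦ (−1)^n·p^{n−1}·e_0` and `e_{n−1} ↦ p⁻¹·e_{n−1}`)
satisfy:
(a) for `1 ≤ i ≤ n−1`, `μ(b₁^i) = μ(b₂^i)` is the decreasing tuple with `i`
entries `n−i` and `n−i` entries `−i`;
(b) `b₁^n = (−1)^{n−1}·I`, so `μ(b₁^n) = (0,…,0)`, while
`μ(b₂^n) = (n, 0,…,0, −n)`;
(c) `b₂^{n−1} = diag((−1)^n·p,…,(−1)^n·p, p^{1−n})`.
-/

open Matrix

noncomputable section

variable (p : ℕ) [Fact p.Prime] (κ : Type) [Field κ] [IsAlgClosed κ] [CharP κ p]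

local notation "𝕎" => WittVector p κ
local notation "K" => FractionRing (WittVector p κ)

/-- The matrix `b₁` (0-indexed columns). -/
def bOne (n : ℕ) : Matrix (Fin n) (Fin n) K :=
  fun r j =>
    if (j : ℕ) + 1 = n then (if (r : ℕ) = 0 then (-1 : K) ^ (n - 1) * (p : K) ^ (n - 1) else 0)
    else (if (r : ℕ) = (j : ℕ) + 1 then (p : K)⁻¹ else 0)

/-- The matrix `b₂` (0-indexed columns). -/
def bTwo (n : ℕ) : Matrix (Fin n) (Fin n) K :=
  fun r j =>
    if (j : ℕ) + 1 = n then (if (r : ℕ) + 1 = n then (p : K)⁻¹ else 0)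
    else if (j : ℕ) + 2 = n then (if (r : ℕ) = 0 then (-1 : K) ^ n * (p : K) ^ (n - 1) else 0)
    else (if (r : ℕ) = (j : ℕ) + 1 then (p : K)⁻¹ else 0)

/-- Cyclic matrix with corner entry `x` and subdiagonal entries `y`. -/
def gOne {R : Type*} [CommRing R] (n : ℕ) (x y : R) : Matrix (Fin n) (Fin n) R :=
  fun r j =>
    if (j : ℕ) + 1 = n then (if (r : ℕ) = 0 then x else 0)
    else (if (r : ℕ) = (j : ℕ) + 1 then y else 0)

/-- Cyclic block of size `n - 1` together with a last diagonal entry `y`. -/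
def gTwo {R : Type*} [CommRing R] (n : ℕ) (x y : R) : Matrix (Fin n) (Fin n) R :=
  fun r j =>
    if (j : ℕ) + 1 = n then (if (r : ℕ) + 1 = n then y else 0)
    else if (j : ℕ) + 2 = n then (if (r : ℕ) = 0 then x else 0)
    else (if (r : ℕ) = (j : ℕ) + 1 then y else 0)

theorem gOne_det {R : Type*} [CommRing R] (m : ℕ) (x y : R) :
    (gOne (m + 1) x y).det = (-1) ^ m * x * y ^ m := by
  rw [Matrix.det_succ_row_zero, Finset.sum_eq_single (Fin.last m)]
  · have h : (gOne (m + 1) x y).submatrix Fin.succ (Fin.last m).succAbove =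
        Matrix.diagonal (fun _ : Fin m => y) := by
      ext r j
      have hj := j.2
      simp only [gOne, Matrix.submatrix_apply, Fin.succAbove_last, Matrix.diagonal_apply,
        Fin.val_succ, Fin.val_castSucc, Fin.ext_iff]
      rw [if_neg (by omega)]
      simp
    rw [h, Matrix.det_diagonal]
    simp [gOne]
  · intro j _ hj
    have : (j : ℕ) ≠ m := fun h => hj (Fin.ext h)
    simp [gOne, this]
  · simp

theorem gTwo_det {R : Type*} [CommRing R] (m : ℕ) (x y : R) :
    (gTwo (m + 2) x y).det = (-1) ^ m * x * y ^ (m + 1) := by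
  rw [Matrix.det_succ_column _ (Fin.last (m + 1)), Finset.sum_eq_single (Fin.last (m + 1))]
  · have h : (gTwo (m + 2) x y).submatrix (Fin.last (m + 1)).succAbove
        (Fin.last (m + 1)).succAbove = gOne (m + 1) x y := by
      ext r j
      have hj := j.2
      simp only [gOne, gTwo, Matrix.submatrix_apply, Fin.succAbove_last, Fin.val_castSucc]
      rw [if_neg (by omega)]
      simp
    rw [h, gOne_det]
    simp only [gTwo, Fin.val_last, if_true]
    rw [Even.neg_one_pow ⟨m + 1, rfl⟩]
    ring
  · intro j _ hj
    have : (j : ℕ) ≠ m + 1 := fun h => hj (Fin.ext h)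
    simp [gTwo, this]
  · simp

theorem mul_gOne {R : Type*} [CommRing R] {n : ℕ} (M : Matrix (Fin n) (Fin n) R) (x y : R)
    (r j : Fin n) : (M * gOne n x y) r j =
      if h : (j : ℕ) + 1 = n then M r ⟨0, by omega⟩ * x
      else M r ⟨j + 1, by have := j.2; omega⟩ * y := by
  rw [Matrix.mul_apply]
  split_ifs with h
  · rw [Finset.sum_eq_single ⟨0, by omega⟩]
    · simp [gOne, h]
    · intro k _ hk
      have : (k : ℕ) ≠ 0 := fun h => hk (Fin.ext h)
      simp [gOne, h, this]
    · simp
  · rw [Finset.sum_eq_single ⟨j + 1, by have := j.2; omega⟩]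
    · simp [gOne, h]
    · intro k _ hk
      have : (k : ℕ) ≠ j + 1 := fun h => hk (Fin.ext h)
      simp [gOne, h, this]
    · simp

theorem mul_gTwo {R : Type*} [CommRing R] {n : ℕ} (M : Matrix (Fin n) (Fin n) R) (x y : R)
    (r j : Fin n) : (M * gTwo n x y) r j =
      if h : (j : ℕ) + 1 = n then M r j * y
      else if h : (j : ℕ) + 2 = n then M r ⟨0, by omega⟩ * x
      else M r ⟨j + 1, by have := j.2; omega⟩ * y := by
  rw [Matrix.mul_apply]
  split_ifs with h h2
  · rw [Finset.sum_eq_single j]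
    · simp [gTwo, h]
    · intro k _ hk
      have h3 : (k : ℕ) ≠ j := fun h => hk (Fin.ext h)
      have : (k : ℕ) + 1 ≠ n := by omega
      simp [gTwo, h, this]
    · simp
  · rw [Finset.sum_eq_single ⟨0, by omega⟩]
    · simp [gTwo, h, h2]
    · intro k _ hk
      have : (k : ℕ) ≠ 0 := fun h => hk (Fin.ext h)
      simp [gTwo, h, h2, this]
    · simp
  · rw [Finset.sum_eq_single ⟨j + 1, by have := j.2; omega⟩]
    · simp [gTwo, h, h2]
    · intro k _ hk
      have : (k : ℕ) ≠ j + 1 := fun h => hk (Fin.ext h)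
      simp [gTwo, h, h2, this]
    · simp

theorem gOne_pow {R : Type*} [CommRing R] {n : ℕ} (x : R) (i : ℕ) (hi : i ≤ n) (r j : Fin n) :
    (gOne n x 1 ^ i) r j =
      if (r : ℕ) = j + i then 1 else if (r : ℕ) + n = j + i then x else 0 := by
  induction i generalizing r j with
  | zero =>
    have := j.2
    have h : ¬ ((r : ℕ) + n = j + 0) := by omega
    rw [if_neg h]
    simp [Matrix.one_apply, Fin.ext_iff]
  | succ i ih =>
    have := j.2
    have := r.2
    rw [pow_succ, mul_gOne]
    split_ifs <;> rw [ih (by omega)] <;> simp only <;> (try split_ifs) <;>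
      first | omega | simp

theorem gTwo_pow {R : Type*} [CommRing R] {n : ℕ} (x : R) (i : ℕ) (hi : i + 1 ≤ n)
    (r j : Fin n) :
    (gTwo n x 1 ^ i) r j =
      if (j : ℕ) + 1 = n ∨ (r : ℕ) + 1 = n then (if r = j then 1 else 0)
      else if (r : ℕ) = j + i then 1 else if (r : ℕ) + (n - 1) = j + i then x else 0 := by
  induction i generalizing r j with
  | zero =>
    have := j.2
    have := r.2
    simp only [pow_zero, Matrix.one_apply, Fin.ext_iff]
    split_ifs <;> first | omega | rfl
  | succ i ih =>
    have := j.2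
    have := r.2
    rw [pow_succ, mul_gTwo]
    split_ifs <;> rw [ih (by omega)] <;> simp only [Fin.ext_iff] at * <;> (try split_ifs) <;>
      first | omega | simp

theorem isHodgePoint_of {n : ℕ} (b : Matrix (Fin n) (Fin n) K) (μ : Fin n → ℤ)
    (hμ : Antitone μ) (S : Matrix (Fin n) (Fin n) 𝕎) (hS : IsUnit S.det)
    (h : b = Matrix.diagonal (fun i => (p : K) ^ (μ i)) * S.map (algebraMap 𝕎 K)) :
    IsHodgePoint p κ b μ :=
  ⟨hμ, 1, S.map (algebraMap 𝕎 K), ⟨1, by simp, by simp⟩, ⟨S, hS, rfl⟩, by rw [h, one_mul]⟩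

theorem gOne_map {n : ℕ} (x y : 𝕎) :
    (gOne n x y).map (algebraMap 𝕎 K) = gOne n (algebraMap 𝕎 K x) (algebraMap 𝕎 K y) := by
  ext r j
  simp only [gOne, Matrix.map_apply]
  split_ifs <;> simp

theorem gTwo_map {n : ℕ} (x y : 𝕎) :
    (gTwo n x y).map (algebraMap 𝕎 K) = gTwo n (algebraMap 𝕎 K x) (algebraMap 𝕎 K y) := by
  ext r j
  simp only [gTwo, Matrix.map_apply]
  split_ifs <;> simp

theorem inv_mul_aux {F : Type*} [Field F] {q : F} (hq : q ≠ 0) {a b : ℤ} (h : b = a - 1) :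
    q⁻¹ * q ^ a = q ^ b * 1 := by
  rw [h, zpow_sub_one₀ hq, mul_one, mul_comm]

theorem bOne_pow (n i : ℕ) (hi : i ≤ n) :
    (bOne p κ n) ^ i = Matrix.diagonal (fun j : Fin n =>
      (p : K) ^ (if (j : ℕ) < i then (n : ℤ) - i else -(i : ℤ))) *
      (gOne n ((-1 : K) ^ (n - 1)) 1) ^ i := by
  have hp := p_ne p κ
  induction i with
  | zero => simp
  | succ i ih =>
    rw [pow_succ', ih (by omega), pow_succ' (gOne _ _ _), ← mul_assoc, ← mul_assoc]
    congr 1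
    ext r j
    have := j.2
    have := r.2
    rw [Matrix.mul_diagonal, Matrix.diagonal_mul]
    simp only [bOne, gOne]
    split_ifs <;> first
      | omega
      | (simp only [zero_mul, mul_zero]; done)
      | (apply inv_mul_aux hp; push_cast; ring)
      | (rw [← zpow_natCast (p : K), mul_assoc, ← zpow_add₀ hp, mul_comm]; congr 2
         rw [Nat.cast_sub (by omega)]; push_cast; ring)

theorem bTwo_pow (n i : ℕ) (hi : i + 1 ≤ n) :
    (bTwo p κ n) ^ i = Matrix.diagonal (fun j : Fin n =>
      (p : K) ^ (if (j : ℕ) < i then (n : ℤ) - i else -(i : ℤ))) *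
      (gTwo n ((-1 : K) ^ n) 1) ^ i := by
  have hp := p_ne p κ
  induction i with
  | zero => simp
  | succ i ih =>
    rw [pow_succ', ih (by omega), pow_succ' (gTwo _ _ _), ← mul_assoc, ← mul_assoc]
    congr 1
    ext r j
    have := j.2
    have := r.2
    rw [Matrix.mul_diagonal, Matrix.diagonal_mul]
    simp only [bTwo, gTwo]
    split_ifs <;> first
      | omega
      | (simp only [zero_mul, mul_zero]; done)
      | (apply inv_mul_aux hp; push_cast; ring)
      | (rw [← zpow_natCast (p : K), mul_assoc, ← zpow_add₀ hp, mul_comm]; congr 2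
         rw [Nat.cast_sub (by omega)]; push_cast; ring)

theorem bTwo_pow_n (n : ℕ) (hn : 2 ≤ n) :
    (bTwo p κ n) ^ n = Matrix.diagonal (fun j : Fin n =>
      (p : K) ^ (if (j : ℕ) = 0 then (n : ℤ) else if (j : ℕ) + 1 = n then -(n : ℤ) else 0)) *
      (gTwo n ((-1 : K) ^ n) 1) ^ n := by
  have hp := p_ne p κ
  obtain ⟨m, rfl⟩ : ∃ m, n = m + 1 := ⟨n - 1, by omega⟩
  rw [pow_succ', bTwo_pow p κ _ m le_rfl, pow_succ' (gTwo _ _ _), ← mul_assoc, ← mul_assoc]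
  congr 1
  ext r j
  have := j.2
  have := r.2
  rw [Matrix.mul_diagonal, Matrix.diagonal_mul]
  simp only [bTwo, gTwo]
  split_ifs <;> first
    | omega
    | (simp only [zero_mul, mul_zero]; done)
    | (apply inv_mul_aux hp; push_cast; ring)
    | (rw [← zpow_natCast (p : K), mul_assoc, ← zpow_add₀ hp, mul_comm]; congr 2
       rw [Nat.cast_sub (by omega)]; push_cast; ring)

theorem statement_15 (n : ℕ) (hn : 2 ≤ n) :
    (bOne p κ n).det = 1 ∧ (bTwo p κ n).det = 1 ∧
    (∀ i : ℕ, 1 ≤ i → i ≤ n - 1 →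
      IsHodgePoint p κ ((bOne p κ n) ^ i)
        (fun j => if (j : ℕ) < i then (n : ℤ) - i else -(i : ℤ)) ∧
      IsHodgePoint p κ ((bTwo p κ n) ^ i)
        (fun j => if (j : ℕ) < i then (n : ℤ) - i else -(i : ℤ))) ∧
    ((bOne p κ n) ^ n = (-1 : K) ^ (n - 1) • (1 : Matrix (Fin n) (Fin n) K)) ∧
    IsHodgePoint p κ ((bOne p κ n) ^ n) (fun _ => 0) ∧
    IsHodgePoint p κ ((bTwo p κ n) ^ n)
      (fun j => if (j : ℕ) = 0 then (n : ℤ) else if (j : ℕ) + 1 = n then -(n : ℤ) else 0) ∧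
    ((bTwo p κ n) ^ (n - 1) =
      Matrix.diagonal fun j : Fin n =>
        if (j : ℕ) + 1 = n then (p : K) ^ ((1 : ℤ) - n) else (-1 : K) ^ n * (p : K)) := by
  have hp := p_ne p κ
  have hb1 : bOne p κ n = gOne n ((-1 : K) ^ (n - 1) * (p : K) ^ (n - 1)) (p : K)⁻¹ := rfl
  have hb2 : bTwo p κ n = gTwo n ((-1 : K) ^ n * (p : K) ^ (n - 1)) (p : K)⁻¹ := rfl
  have hu : ∀ k : ℕ, IsUnit ((-1 : 𝕎) ^ k) := fun k => (isUnit_one.neg).pow k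
  have hS1 : ∀ i : ℕ, IsUnit ((gOne n ((-1 : 𝕎) ^ (n - 1)) 1) ^ i).det := by
    intro i
    obtain ⟨m, rfl⟩ : ∃ m, n = m + 1 := ⟨n - 1, by omega⟩
    rw [Matrix.det_pow, gOne_det]
    simpa using (((hu m).mul (hu m)).pow i)
  have hS2 : ∀ i : ℕ, IsUnit ((gTwo n ((-1 : 𝕎) ^ n) 1) ^ i).det := by
    intro i
    obtain ⟨m, rfl⟩ : ∃ m, n = m + 2 := ⟨n - 2, by omega⟩
    rw [Matrix.det_pow, gTwo_det, one_pow, mul_one]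
    exact ((hu m).mul (hu (m + 2))).pow i
  have hm1 : ∀ i : ℕ, ((gOne n ((-1 : 𝕎) ^ (n - 1)) 1) ^ i).map (algebraMap 𝕎 K) =
      (gOne n ((-1 : K) ^ (n - 1)) 1) ^ i := by
    intro i
    rw [Matrix.map_pow, gOne_map]
    simp
  have hm2 : ∀ i : ℕ, ((gTwo n ((-1 : 𝕎) ^ n) 1) ^ i).map (algebraMap 𝕎 K) =
      (gTwo n ((-1 : K) ^ n) 1) ^ i := by
    intro i
    rw [Matrix.map_pow, gTwo_map]
    simp
  have hanti : ∀ i : ℕ, Antitone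
      (fun j : Fin n => if (j : ℕ) < i then (n : ℤ) - i else -(i : ℤ)) := by
    intro i a b hab
    have : (a : ℕ) ≤ b := hab
    simp only
    split_ifs <;> omega
  have hpow1 : (bOne p κ n) ^ n = (-1 : K) ^ (n - 1) • (1 : Matrix (Fin n) (Fin n) K) := by
    rw [bOne_pow p κ n n le_rfl]
    ext r j
    have := j.2
    have := r.2
    rw [Matrix.diagonal_mul, gOne_pow _ _ le_rfl]
    simp only [Matrix.smul_apply, Matrix.one_apply, Fin.ext_iff]
    split_ifs <;> first | omega | simp
  refine ⟨?_, ?_, ?_, hpow1, ?_, ?_, ?_⟩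
  · obtain ⟨m, rfl⟩ : ∃ m, n = m + 1 := ⟨n - 1, by omega⟩
    rw [hb1, gOne_det, Nat.add_sub_cancel, ← mul_assoc, ← mul_pow, mul_assoc, ← mul_pow,
      mul_inv_cancel₀ hp]
    simp
  · obtain ⟨m, rfl⟩ : ∃ m, n = m + 2 := ⟨n - 2, by omega⟩
    rw [hb2, gTwo_det, ← mul_assoc, mul_assoc, show m + 2 - 1 = m + 1 from rfl, ← mul_pow,
      mul_inv_cancel₀ hp, ← pow_add, Even.neg_one_pow ⟨m + 1, by ring⟩]
    simp
  · intro i _ hi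
    refine ⟨isHodgePoint_of p κ _ _ (hanti i) _ (hS1 i) ?_,
      isHodgePoint_of p κ _ _ (hanti i) _ (hS2 i) ?_⟩
    · rw [hm1]
      exact bOne_pow p κ n i (by omega)
    · rw [hm2]
      exact bTwo_pow p κ n i (by omega)
  · refine isHodgePoint_of p κ _ _ antitone_const _ (hS1 n) ?_
    rw [hm1, bOne_pow p κ n n le_rfl]
    congr 2
    ext j
    simp
  · refine isHodgePoint_of p κ _ _ ?_ _ (hS2 n) ?_
    · intro a b hab
      have : (a : ℕ) ≤ b := hab
      have := b.2
      simp only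
      split_ifs <;> omega
    · rw [hm2]
      exact bTwo_pow_n p κ n hn
  · rw [bTwo_pow p κ n (n - 1) (by omega)]
    ext r j
    have := j.2
    have := r.2
    rw [Matrix.diagonal_mul, gTwo_pow _ _ (by omega), Matrix.diagonal_apply]
    simp only [Fin.ext_iff]
    split_ifs <;> first
      | omega
      | (simp only [mul_zero]; done)
      | (rw [mul_one]; congr 1; rw [Nat.cast_sub (by omega)]; push_cast; ring)
      | (rw [mul_comm]; congr 1; rw [Nat.cast_sub (by omega)]; simp)

end
end

section
/- Let g ≥ 1 and b = (b_0,…,b_{g−1}) ∈ GL_2(K)^g. Assume μ(b_i) = (1, 0) for every i ∈ ℤ/gℤ. Let τ ⊆ ℤ/gℤ be such that μ(b_i·σ(b_{i−1})) = (1, 1) for every i ∈ τ, and let τ' ⊆ τ be spaced, i.e. for every i ∈ τ' one has i+1 ∉ τ' (addition in ℤ/gℤ). Then for every n ≥ 1 and every i ∈ ℤ/gℤ, the smaller Hodge slope μ(((b∗σ)^{ng})_i)_2 is at least (n−1)·|τ'|. (This is the key estimate bounding the Newton slopes on the Goren–Oort stratum of type τ by λ(τ) and 1−λ(τ), where λ(τ)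 = (1/g)·max{|τ'| : τ' ⊆ τ spaced} except λ(τ) = 1/2 when g is odd and τ = ℤ/gℤ.) -/
/-!
Statement 16.  Let `g ≥ 1` and `b ∈ GL_2(K)^g` with `μ(b_i) = (1,0)` for all
`i ∈ ℤ/gℤ`.  Let `τ ⊆ ℤ/gℤ` with `μ(b_i·σ(b_{i−1})) = (1,1)` for all `i ∈ τ`,
and let `τ' ⊆ τ` be spaced (`i ∈ τ' → i+1 ∉ τ'`).  Then for every `n ≥ 1` and
every `i ∈ ℤ/gℤ`, the smaller Hodge slope of `((b∗σ)^{ng})_i` is at least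
`(n−1)·|τ'|`.
-/

open Matrix

noncomputable section

variable (p : ℕ) [Fact p.Prime] (κ : Type) [Field κ] [IsAlgClosed κ] [CharP κ p]

local notation "𝕎" => WittVector p κ
local notation "K" => FractionRing (WittVector p κ)

/-- `starPow σ b k i = ((b∗σ)^k)_i = b_i·σ(b_{i−1})···σ^{k−1}(b_{i−k+1})`. -/
def starPow {g : ℕ} (σ : K ≃+* K) (b : ZMod g → Matrix (Fin 2) (Fin 2) K) :
    ℕ → ZMod g → Matrix (Fin 2) (Fin 2) K
  | 0, _ => 1
  | (k + 1), i => b i * (starPow σ b k (i - 1)).map ⇑σ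

def DivBy (k : ℕ) (M : Matrix (Fin 2) (Fin 2) K) : Prop :=
  ∃ N : Matrix (Fin 2) (Fin 2) 𝕎, M = ((p : 𝕎) ^ k • N).map (algebraMap 𝕎 K)

theorem DivBy.mul {a c : ℕ} {M N : Matrix (Fin 2) (Fin 2) K} (hM : DivBy p κ a M)
    (hN : DivBy p κ c N) : DivBy p κ (a + c) (M * N) := by
  obtain ⟨M', rfl⟩ := hM
  obtain ⟨N', rfl⟩ := hN
  refine ⟨M' * N', ?_⟩
  rw [← Matrix.map_mul, Matrix.smul_mul, Matrix.mul_smul, smul_smul, pow_add]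

theorem DivBy.sig {σ : K ≃+* K}
    (hσ : ∀ x : 𝕎, σ (algebraMap 𝕎 K x) = algebraMap 𝕎 K (WittVector.frobenius x))
    {a : ℕ} {M : Matrix (Fin 2) (Fin 2) K} (hM : DivBy p κ a M) :
    DivBy p κ a (M.map ⇑σ) := by
  obtain ⟨M', rfl⟩ := hM
  refine ⟨M'.map WittVector.frobenius, ?_⟩
  ext i j
  simp only [Matrix.map_apply, Matrix.smul_apply, smul_eq_mul, hσ, map_mul, map_pow, map_natCast]

theorem IsIntegralUnit.divBy {c : Matrix (Fin 2) (Fin 2) K} (h : IsIntegralUnit p κ c) :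
    DivBy p κ 0 c := by
  obtain ⟨d, -, rfl⟩ := h
  exact ⟨d, by simp⟩

theorem IsIntegralUnit.inv {c : Matrix (Fin 2) (Fin 2) K} (h : IsIntegralUnit p κ c) :
    ∃ e : Matrix (Fin 2) (Fin 2) K, DivBy p κ 0 e ∧ e * c = 1 ∧ c * e = 1 := by
  obtain ⟨d, hd, rfl⟩ := h
  refine ⟨d⁻¹.map (algebraMap 𝕎 K), ⟨d⁻¹, by simp⟩, ?_, ?_⟩
  · rw [← Matrix.map_mul, Matrix.nonsing_inv_mul _ hd]; simp
  · rw [← Matrix.map_mul, Matrix.mul_nonsing_inv _ hd]; simp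

theorem IsHodgePoint.divBy {M : Matrix (Fin 2) (Fin 2) K} {x y : ℕ}
    (h : IsHodgePoint p κ M ![(x + y : ℤ), (x : ℤ)]) : DivBy p κ x M := by
  obtain ⟨-, c₁, c₂, h₁, h₂, rfl⟩ := h
  have hd : DivBy p κ x
      (Matrix.diagonal (fun i => (p : K) ^ ((![(x + y : ℤ), (x : ℤ)] : Fin 2 → ℤ) i))) := by
    refine ⟨Matrix.diagonal ![(p : 𝕎) ^ y, 1], ?_⟩
    ext i j
    fin_cases i <;> fin_cases j <;> simp
    rw [← pow_add]
    exact_mod_cast zpow_natCast (p : K) (x + y)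
  simpa using ((h₁.divBy p κ).mul p κ hd).mul p κ (h₂.divBy p κ)

theorem IsHodgePoint.le {M : Matrix (Fin 2) (Fin 2) K} {k : ℕ} {μ : Fin 2 → ℤ}
    (h : IsHodgePoint p κ M μ) (hM : DivBy p κ k M) : (k : ℤ) ≤ μ 1 := by
  obtain ⟨-, c₁, c₂, h₁, h₂, rfl⟩ := h
  obtain ⟨e₁, he₁, h₁', -⟩ := h₁.inv
  obtain ⟨e₂, he₂, -, h₂'⟩ := h₂.inv
  obtain ⟨N, hN⟩ := (he₁.mul p κ hM).mul p κ he₂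
  have hN' : Matrix.diagonal (fun i => (p : K) ^ (μ i)) =
      ((p : 𝕎) ^ (0 + k + 0) • N).map (algebraMap 𝕎 K) := by
    rw [← hN]
    simp only [mul_assoc, h₂', mul_one]
    rw [← mul_assoc, h₁', one_mul]
  have h11 := congrFun (congrFun hN' 1) 1
  simp at h11
  by_contra! hlt
  obtain ⟨m, hm⟩ : ∃ m : ℕ, (k : ℤ) = μ 1 + (m + 1) := ⟨(k - μ 1 - 1).toNat, by omega⟩
  have hirr := WittVector.irreducible (p := p) (k := κ)
  have hp : (p : K) ≠ 0 := by
    have := (map_ne_zero_iff _ (IsFractionRing.injective 𝕎 K)).2 hirr.ne_zero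
    simpa using this
  apply hirr.not_isUnit
  refine IsUnit.of_mul_eq_one ((p : 𝕎) ^ m * N 1 1) ?_
  apply IsFractionRing.injective 𝕎 K
  rw [← zpow_natCast, hm, zpow_add₀ hp] at h11
  have := mul_left_cancel₀ (zpow_ne_zero (μ 1) hp) (((mul_one _).trans h11).trans (mul_assoc _ _ _))
  simp only [map_mul, map_pow, map_natCast, map_one]
  rw [this, ← mul_assoc, ← pow_succ']
  norm_cast

def cnt {g : ℕ} (s : Finset (ZMod g)) (k : ℕ) (i : ZMod g) : ℕ :=
  ∑ t ∈ Finset.range k, if i - (t : ZMod g) ∈ s then 1 else 0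

theorem cnt_succ {g : ℕ} (s : Finset (ZMod g)) (k : ℕ) (i : ZMod g) :
    cnt s (k + 1) i = (if i ∈ s then 1 else 0) + cnt s k (i - 1) := by
  unfold cnt
  rw [Finset.sum_range_succ', add_comm]
  simp [sub_sub, add_comm]

theorem cnt_add {g : ℕ} (s : Finset (ZMod g)) (k l : ℕ) (i : ZMod g) :
    cnt s (k + l) i = cnt s k i + cnt s l (i - k) := by
  unfold cnt
  rw [Finset.sum_range_add]
  simp [sub_sub]

theorem cnt_self {g : ℕ} (hg : 1 ≤ g) (s : Finset (ZMod g)) (i : ZMod g) :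
    s.card ≤ cnt s g i := by
  haveI : NeZero g := ⟨by omega⟩
  unfold cnt
  rw [← Finset.card_filter]
  refine Finset.card_le_card_of_injOn (fun j => (i - j).val) ?_ ?_
  · intro j hj
    simp [ZMod.val_lt]
    exact hj
  · intro a _ c _ h
    have := ZMod.val_injective g h
    simpa using this

theorem cnt_mul {g : ℕ} (hg : 1 ≤ g) (s : Finset (ZMod g)) (m : ℕ) (i : ZMod g) :
    m * s.card ≤ cnt s (m * g) i := by
  induction m with
  | zero => simp
  | succ m ih =>
    rw [add_mul, add_mul, cnt_add, one_mul, one_mul]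
    exact add_le_add ih (cnt_self hg s _)

theorem DivBy.mono {a c : ℕ} (hac : a ≤ c) {M : Matrix (Fin 2) (Fin 2) K}
    (hM : DivBy p κ c M) : DivBy p κ a M := by
  obtain ⟨M', rfl⟩ := hM
  obtain ⟨d, rfl⟩ := Nat.exists_eq_add_of_le hac
  exact ⟨(p : 𝕎) ^ d • M', by rw [smul_smul, pow_add]⟩

theorem starPow_divBy {g : ℕ} (σ : K ≃+* K)
    (hσ : ∀ x : 𝕎, σ (algebraMap 𝕎 K x) = algebraMap 𝕎 K (WittVector.frobenius x))
    (b : ZMod g → Matrix (Fin 2) (Fin 2) K)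
    (hb : ∀ i : ZMod g, DivBy p κ 0 (b i))
    (s : Finset (ZMod g)) (hs : ∀ i ∈ s, i + 1 ∉ s)
    (hτ : ∀ i ∈ s, DivBy p κ 1 (b i * (b (i - 1)).map ⇑σ)) (k : ℕ) :
    ∀ i, DivBy p κ (cnt s (k - 1) i) (starPow p κ σ b k i) := by
  induction k using Nat.strong_induction_on with
  | _ k ih =>
    intro i
    match k, ih with
    | 0, _ => exact ⟨1, by simp [starPow, cnt]⟩
    | 1, _ =>
      have : starPow p κ σ b 1 i = b i := by simp [starPow, Matrix.map_one]
      rw [this]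
      simpa [cnt] using hb i
    | k + 2, ih =>
      by_cases hi : i ∈ s
      · have hi' : i - 1 ∉ s := fun h => hs _ h (by simpa using hi)
        have e : starPow p κ σ b (k + 2) i =
            (b i * (b (i - 1)).map ⇑σ) * ((starPow p κ σ b k (i - 1 - 1)).map ⇑σ).map ⇑σ := by
          simp only [starPow]
          rw [Matrix.map_mul, mul_assoc]
        rw [e]
        have := (hτ i hi).mul p κ (((ih k (by omega) (i - 1 - 1)).sig p κ hσ).sig p κ hσ)
        refine this.mono p κ ?_
        rw [show k + 2 - 1 = k + 1 from rfl, cnt_succ, if_pos hi]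
        rcases k with _ | k
        · simp [cnt]
        · rw [cnt_succ, if_neg hi']; simp
      · have := (hb i).mul p κ ((ih (k + 1) (by omega) (i - 1)).sig p κ hσ)
        refine this.mono p κ ?_
        rw [show k + 2 - 1 = k + 1 from rfl, cnt_succ, if_neg hi]
        simp

theorem statement_16 (g : ℕ) (hg : 1 ≤ g) (σ : K ≃+* K)
    (hσ : ∀ x : 𝕎, σ (algebraMap 𝕎 K x) = algebraMap 𝕎 K (WittVector.frobenius x))
    (b : ZMod g → Matrix (Fin 2) (Fin 2) K)
    (hb : ∀ i : ZMod g, IsHodgePoint p κ (b i) ![1, 0])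
    (τ τ' : Finset (ZMod g)) (hττ' : τ' ⊆ τ)
    (hspaced : ∀ i ∈ τ', i + 1 ∉ τ')
    (hτ : ∀ i ∈ τ, IsHodgePoint p κ (b i * (b (i - 1)).map ⇑σ) ![1, 1])
    (n : ℕ) (hn : 1 ≤ n) (i : ZMod g)
    (μ : Fin 2 → ℤ) (hμ : IsHodgePoint p κ (starPow p κ σ b (n * g) i) μ) :
    ((n : ℤ) - 1) * (τ'.card : ℤ) ≤ μ 1 := by
  have hb' : ∀ i, DivBy p κ 0 (b i) := fun i =>
    IsHodgePoint.divBy p κ (x := 0) (y := 1) (by simpa using hb i)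
  have ht' : ∀ i ∈ τ', DivBy p κ 1 (b i * (b (i - 1)).map ⇑σ) := fun i hi =>
    IsHodgePoint.divBy p κ (x := 1) (y := 0) (by simpa using hτ i (hττ' hi))
  have h := starPow_divBy p κ σ hσ b hb' τ' hspaced ht' (n * g) i
  obtain ⟨m, rfl⟩ := Nat.exists_eq_add_of_le' hn
  have hle : m * τ'.card ≤ cnt τ' ((m + 1) * g - 1) i := by
    have : (m + 1) * g - 1 = m * g + (g - 1) := by rw [add_mul]; omega
    rw [this, cnt_add]
    exact (cnt_mul hg τ' m i).trans (Nat.le_add_right _ _)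
  have := hμ.le p κ (h.mono p κ hle)
  push_cast at this ⊢
  simpa using this

end
end
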